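/- arXiv:1311.7165 — 2 statements merged into one kernel-verified Lean document; each statement's English description precedes it below -/
import Mathlib

section
/- Let Ω ⊂ ℝ^N be a bounded open set, and suppose K satisfies the integrability, symmetry and radial monotonicity conditions with critical exponent s₀ > 0. Then any bounded subset 𝒯 of X₀ (with norm ‖·‖_X) is totally bounded (pre-compact) in L²(Ω). -/
open MeasureTheory Filter Topology Set
open scoped ENNReal

noncomputable def kernelTail (N : ℕ) (K : EuclideanSpace ℝ (Fin N) → ℝ) (r : ℝ) : ℝ≥0∞ :=
  ∫⁻ y in {y : EuclideanSpace ℝ (Fin N) | r ≤ ‖y‖}, ENNReal.ofReal (K y)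

def kernelIntegrable (N : ℕ) (K : EuclideanSpace ℝ (Fin N) → ℝ) : Prop :=
  ∫⁻ x : EuclideanSpace ℝ (Fin N), ENNReal.ofReal (min (‖x‖ ^ 2) 1 * K x) < ⊤

noncomputable def kernelS0 (N : ℕ) (K : EuclideanSpace ℝ (Fin N) → ℝ) : ℝ :=
  sSup {s : ℝ | 0 ≤ s ∧
    Tendsto (fun r : ℝ => ENNReal.ofReal (r ^ (2 * s)) * kernelTail N K r) (𝓝[>] (0 : ℝ)) (𝓝 ⊤)}

theorem exists_lt_norm_pow_mul_kernel {N : ℕ} (hN : 1 ≤ N) {K : EuclideanSpace ℝ (Fin N) → ℝ}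
    (hmeas : Measurable K) (hpos : ∀ x, x ≠ 0 → 0 < K x) (hint : kernelIntegrable N K)
    (hs0 : 0 < kernelS0 N K) (C : ℝ) : ∃ v, v ≠ 0 ∧ C < ‖v‖ ^ N * K v := by
  by_contra! hC
  obtain ⟨s, ⟨-, hs⟩, hs_pos⟩ : ∃ s ∈ {s : ℝ | 0 ≤ s ∧ Tendsto
      (fun r : ℝ => ENNReal.ofReal (r ^ (2 * s)) * kernelTail N K r) (𝓝[>] (0 : ℝ)) (𝓝 ⊤)},
      0 < s := by
    refine exists_lt_of_lt_csSup (Set.nonempty_iff_ne_empty.2 fun h => ?_) hs0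
    rw [kernelS0, h, Real.sSup_empty] at hs0
    exact hs0.false
  have hball : IntegrableOn (fun x : EuclideanSpace ℝ (Fin N) => ‖x‖ ^ (2 * s) * K x)
      (Metric.ball 0 1) := by
    have := Fin.pos_iff_nonempty.1 hN
    refine integrableOn_ball_of_norm_le_rpow (C := C) (α := N - 2 * s) (by simpa using hN)
      (by simpa using hs_pos) (ae_restrict_of_ae ?_) (by fun_prop)
    filter_upwards [Measure.ae_ne volume (0 : EuclideanSpace ℝ (Fin N))] with x hx
    have hx' : 0 < ‖x‖ := norm_pos_iff.2 hx
    rw [Real.norm_of_nonneg (mul_nonneg (by positivity) (hpos x hx).le),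
      neg_sub, Real.rpow_sub hx', Real.rpow_natCast, mul_div_left_comm]
    refine mul_le_mul_of_nonneg_left ?_ (by positivity)
    rw [le_div_iff₀ (by positivity), mul_comm]
    exact hC x hx
  have hbound : ∀ r ∈ Ioo (0 : ℝ) 1, ENNReal.ofReal (r ^ (2 * s)) * kernelTail N K r ≤
      (∫⁻ x in Metric.ball 0 1, ENNReal.ofReal (‖x‖ ^ (2 * s) * K x)) +
        ∫⁻ x : EuclideanSpace ℝ (Fin N), ENNReal.ofReal (min (‖x‖ ^ 2) 1 * K x) := by
    rintro r ⟨hr0, hr1⟩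
    rw [kernelTail, ← lintegral_const_mul _ (by fun_prop),
      ← lintegral_indicator measurableSet_ball,
      ← lintegral_add_right _ (by fun_prop)]
    refine (setLIntegral_mono_ae' (measurableSet_le measurable_const measurable_norm)
      (.of_forall fun x hx => ?_)).trans (setLIntegral_le_lintegral _ _)
    have hrx : r ≤ ‖x‖ := hx
    have hK : 0 ≤ K x := (hpos x (norm_pos_iff.1 (hr0.trans_le hrx))).le
    rw [← ENNReal.ofReal_mul (by positivity)]
    by_cases h1 : ‖x‖ < 1
    · rw [indicator_of_mem (by simpa using h1)]
      refine le_add_right (ENNReal.ofReal_le_ofReal ?_)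
      gcongr
    · refine le_add_left (ENNReal.ofReal_le_ofReal ?_)
      rw [min_eq_right (one_le_pow₀ (not_lt.1 h1))]
      gcongr
      exact Real.rpow_le_one hr0.le hr1.le (by positivity)
  have htop : (⊤ : ℝ≥0∞) ≤ _ := le_of_tendsto hs
    (eventually_of_mem (Ioo_mem_nhdsGT one_pos) hbound)
  refine (ENNReal.add_lt_top.2 ⟨?_, hint⟩).not_ge htop
  exact hball.setLIntegral_lt_top

theorem exists_setLIntegral_sq_sub_add_le {α : Type*} [MeasurableSpace α] {μ : Measure α}
    [SFinite μ] {Q : Set α} (hQ : MeasurableSet Q) (h0 : μ Q ≠ 0) (htop : μ Q ≠ ⊤) {g : α → ℝ}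
    (hg : Measurable g) {W : α × α → ℝ≥0∞} {c : ℝ≥0∞} (hc : c ≠ ⊤)
    (hW : ∀ x ∈ Q, ∀ y ∈ Q, ENNReal.ofReal ((g x - g y) ^ 2) ≤ c * μ Q * W (x, y)) :
    ∃ y ∈ Q, (∫⁻ x in Q, ENNReal.ofReal ((g x - g y) ^ 2) ∂μ) +
        c * μ Q * ENNReal.ofReal (g y ^ 2) ≤
      c * ((∫⁻ p in Q ×ˢ Q, W p ∂(μ.prod μ)) + ∫⁻ x in Q, ENNReal.ofReal (g x ^ 2) ∂μ) := by
  have hcQ : c * μ Q ≠ ⊤ := ENNReal.mul_ne_top hc htop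
  have hm : Measurable fun p : α × α => ENNReal.ofReal ((g p.1 - g p.2) ^ 2) := by fun_prop
  have hmA : Measurable fun y => ∫⁻ x in Q, ENNReal.ofReal ((g x - g y) ^ 2) ∂μ :=
    hm.lintegral_prod_left'
  obtain ⟨y, hy, hle⟩ := exists_le_setLAverage (μ := μ) (s := Q)
    (f := fun y => (∫⁻ x in Q, ENNReal.ofReal ((g x - g y) ^ 2) ∂μ) +
        c * μ Q * ENNReal.ofReal (g y ^ 2)) h0 htop (by fun_prop)
  refine ⟨y, hy, hle.trans ?_⟩
  rw [setLAverage_eq, lintegral_add_left hmA, lintegral_const_mul _ (by fun_prop)]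
  have hdouble : ∫⁻ y in Q, ∫⁻ x in Q, ENNReal.ofReal ((g x - g y) ^ 2) ∂μ ∂μ ≤
      c * μ Q * ∫⁻ p in Q ×ˢ Q, W p ∂(μ.prod μ) := by
    rw [← lintegral_prod_symm' _ hm, Measure.prod_restrict, ← lintegral_const_mul' _ _ hcQ]
    exact setLIntegral_mono_ae' (hQ.prod hQ) (.of_forall fun p hp => hW _ hp.1 _ hp.2)
  refine ENNReal.div_le_of_le_mul ?_
  calc _ ≤ _ := add_le_add_left hdouble _
    _ = _ := by ring

section GridCells

variable {N : ℕ}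

noncomputable def gridIndex (ρ : ℝ) (x : EuclideanSpace ℝ (Fin N)) : Fin N → ℤ :=
  fun i => ⌊x i / ρ⌋

theorem measurable_gridIndex (ρ : ℝ) :
    Measurable (gridIndex ρ : EuclideanSpace ℝ (Fin N) → Fin N → ℤ) :=
  measurable_pi_lambda _ fun i => Int.measurable_floor.comp (by fun_prop)

theorem volume_gridIndex_preimage {ρ : ℝ} (hρ : 0 < ρ) (n : Fin N → ℤ) :
    volume (gridIndex ρ ⁻¹' {n} : Set (EuclideanSpace ℝ (Fin N))) = ENNReal.ofReal (ρ ^ N) := by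
  have h : (gridIndex ρ ⁻¹' {n} : Set (EuclideanSpace ℝ (Fin N))) =
      WithLp.ofLp ⁻¹' (Set.pi univ fun i => Ico (n i * ρ) ((n i + 1) * ρ)) := by
    ext x
    simp [gridIndex, funext_iff, Int.floor_eq_iff, le_div_iff₀ hρ, div_lt_iff₀ hρ]
  rw [h, (PiLp.volume_preserving_ofLp (Fin N)).measure_preimage
    (MeasurableSet.univ_pi fun i => measurableSet_Ico).nullMeasurableSet, Real.volume_pi_Ico]
  simp [add_mul, ENNReal.ofReal_pow hρ.le]

theorem norm_sub_le_of_gridIndex_eq {ρ : ℝ} (hρ : 0 < ρ) {x y : EuclideanSpace ℝ (Fin N)}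
    (h : gridIndex ρ x = gridIndex ρ y) : ‖x - y‖ ≤ √N * ρ := by
  have hi : ∀ i, ‖(x - y) i‖ ^ 2 ≤ ρ ^ 2 := fun i => by
    have := Int.abs_sub_lt_one_of_floor_eq_floor (congrFun h i)
    rw [← sub_div, abs_div, abs_of_pos hρ, div_lt_one hρ] at this
    exact pow_le_pow_left₀ (norm_nonneg _) this.le 2
  rw [EuclideanSpace.norm_eq, ← Real.sqrt_sq hρ.le, ← Real.sqrt_mul (by positivity)]
  refine Real.sqrt_le_sqrt ((Finset.sum_le_sum fun i _ => hi i).trans ?_)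
  simp

theorem finite_gridIndex_image {ρ : ℝ} (hρ : 0 < ρ) {Ω : Set (EuclideanSpace ℝ (Fin N))}
    (hΩ : Bornology.IsBounded Ω) : (gridIndex ρ '' Ω).Finite := by
  obtain ⟨R, hR⟩ := hΩ.exists_norm_le
  refine (Set.finite_Icc (fun _ => ⌊-R / ρ⌋ : Fin N → ℤ) fun _ => ⌊R / ρ⌋).subset ?_
  rintro _ ⟨x, hx, rfl⟩
  have hi : ∀ i, |x i| ≤ R := fun i => (PiLp.norm_apply_le x i).trans (hR x hx)
  constructor <;> intro i <;> refine Int.floor_le_floor ?_ <;> gcongr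
  exacts [(abs_le.1 (hi i)).1, (abs_le.1 (hi i)).2]

end GridCells

theorem Finset.sum_setLIntegral_le_lintegral {α ι : Type*} [MeasurableSpace α] {μ : Measure α}
    {S : Finset ι} {t : ι → Set α} (hd : Set.PairwiseDisjoint (↑S) t)
    (hm : ∀ b ∈ S, MeasurableSet (t b)) (f : α → ℝ≥0∞) :
    ∑ b ∈ S, ∫⁻ a in t b, f a ∂μ ≤ ∫⁻ a, f a ∂μ := by
  rw [← lintegral_biUnion_finset hd hm]
  exact setLIntegral_le_lintegral _ _

theorem eLpNorm_two_lt_ofReal {α : Type*} [MeasurableSpace α] {μ : Measure α} {f : α → ℝ}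
    {ε : ℝ} (hε : 0 ≤ ε) (h : ∫⁻ x, ENNReal.ofReal (f x ^ 2) ∂μ < ENNReal.ofReal (ε ^ 2)) :
    eLpNorm f 2 μ < ENNReal.ofReal ε := by
  rw [eLpNorm_eq_lintegral_rpow_enorm_toReal (by simp) (by simp), ENNReal.toReal_ofNat, one_div,
    ENNReal.rpow_inv_lt_iff two_pos, ENNReal.rpow_ofNat, ← ENNReal.ofReal_pow hε]
  convert h using 3 with x
  rw [ENNReal.rpow_ofNat, ← ofReal_norm, ← ENNReal.ofReal_pow (norm_nonneg _), Real.norm_eq_abs,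
    sq_abs]

theorem exists_finset_abs_sub_le (B : ℝ) {η : ℝ} (hη : 0 < η) :
    ∃ D : Finset ℝ, ∀ t : ℝ, |t| ≤ B → ∃ d ∈ D, |t - d| ≤ η := by
  obtain ⟨D, -, hD, hcov⟩ := (isCompact_Icc (a := -B) (b := B)).finite_cover_balls hη
  refine ⟨hD.toFinset, fun t ht => ?_⟩
  obtain ⟨d, hd, htd⟩ := mem_iUnion₂.1 (hcov (abs_le.1 ht))
  exact ⟨d, by simpa using hd, (Metric.mem_ball.1 htd).le⟩

theorem stmt16 (N : ℕ) (hN : 2 ≤ N) (K : EuclideanSpace ℝ (Fin N) → ℝ)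
    (hmeas : Measurable K)
    (hpos : ∀ x : EuclideanSpace ℝ (Fin N), x ≠ 0 → 0 < K x)
    (hint : kernelIntegrable N K)
    (hsym : ∀ x : EuclideanSpace ℝ (Fin N), K (-x) = K x)
    (hmono : ∀ x y : EuclideanSpace ℝ (Fin N), x ≠ 0 → y ≠ 0 → ‖x‖ ≤ ‖y‖ → K y ≤ K x)
    (hs0 : 0 < kernelS0 N K)
    (Ω : Set (EuclideanSpace ℝ (Fin N))) (hΩo : IsOpen Ω) (hΩb : Bornology.IsBounded Ω)
    (T : Set (EuclideanSpace ℝ (Fin N) → ℝ))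
    (hTmeas : ∀ g ∈ T, Measurable g)
    (hTzero : ∀ g ∈ T, ∀ x ∉ Ω, g x = 0)
    (hTbdd : ∃ M : ℝ, ∀ g ∈ T,
      (∫⁻ x in Ω, ENNReal.ofReal ((g x) ^ 2)) +
        (∫⁻ p in {p : EuclideanSpace ℝ (Fin N) × EuclideanSpace ℝ (Fin N) |
            p.1 ∈ Ω ∨ p.2 ∈ Ω},
          ENNReal.ofReal ((g p.1 - g p.2) ^ 2 * K (p.1 - p.2))) ≤ ENNReal.ofReal M) :
    ∀ ε : ℝ, 0 < ε →
      ∃ F : Finset (EuclideanSpace ℝ (Fin N) → ℝ),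
        ∀ g ∈ T, ∃ h ∈ F,
          eLpNorm (fun x => g x - h x) 2 (volume.restrict Ω) < ENNReal.ofReal ε := by
  intro ε hε
  obtain ⟨M, hM0, hM⟩ : ∃ M : ℝ, 0 ≤ M ∧ ∀ g ∈ T,
      (∫⁻ p : EuclideanSpace ℝ (Fin N) × EuclideanSpace ℝ (Fin N),
        ENNReal.ofReal ((g p.1 - g p.2) ^ 2 * K (p.1 - p.2))) +
      (∫⁻ x, ENNReal.ofReal (g x ^ 2)) ≤ ENNReal.ofReal M := by
    obtain ⟨M, hM⟩ := hTbdd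
    refine ⟨max M 0, le_max_right _ _, fun g hg => ?_⟩
    refine le_trans (le_of_eq ?_) ((hM g hg).trans (ENNReal.ofReal_le_ofReal (le_max_left _ _)))
    rw [add_comm]
    congr 1
    · refine (setLIntegral_eq_of_support_subset fun x hx => ?_).symm
      by_contra hxΩ
      simp [hTzero g hg x hxΩ] at hx
    · refine (setLIntegral_eq_of_support_subset fun p hp => ?_).symm
      by_contra hpΩ
      rw [mem_ofPred_eq, not_or] at hpΩ
      simp [hTzero g hg _ hpΩ.1, hTzero g hg _ hpΩ.2] at hp
  set A : ℝ := volume.real Ω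
  have hA : ENNReal.ofReal A = volume Ω := ofReal_measureReal hΩb.measure_lt_top.ne
  have hA0 : 0 ≤ A := measureReal_nonneg
  set δ : ℝ := ε ^ 2 / (8 * (M + 1)) with hδ_def
  have hδ : 0 < δ := by positivity
  set η : ℝ := ε / (4 * (A + 1)) with hη_def
  have hη : 0 < η := by positivity
  have hN0 : 0 < √(N : ℝ) := Real.sqrt_pos.2 (by exact_mod_cast (by lia : 0 < N))
  obtain ⟨v, hv0, hv⟩ := exists_lt_norm_pow_mul_kernel (by lia) hmeas hpos hint hs0
    (√(N : ℝ) ^ N / δ)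
  set ρ : ℝ := ‖v‖ / √(N : ℝ) with hρ_def
  have hρ : 0 < ρ := div_pos (norm_pos_iff.2 hv0) hN0
  have hkey : 1 ≤ δ * ρ ^ N * K v := by
    rw [div_lt_iff₀ hδ] at hv
    rw [hρ_def, div_pow, mul_div_assoc', div_mul_eq_mul_div, le_div_iff₀ (by positivity)]
    linarith
  set Q : (Fin N → ℤ) → Set (EuclideanSpace ℝ (Fin N)) := fun n => gridIndex ρ ⁻¹' {n} with hQ_def
  have hQm : ∀ n, MeasurableSet (Q n) := fun n =>
    measurable_gridIndex ρ (measurableSet_singleton n)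
  have hQvol : ∀ n, volume (Q n) = ENNReal.ofReal (ρ ^ N) := volume_gridIndex_preimage hρ
  have hQd : Pairwise (Function.onFun Disjoint Q) := pairwise_disjoint_fiber _
  obtain ⟨S, hS⟩ := (finite_gridIndex_image hρ hΩb).exists_finset_coe
  have hΩS : ∀ x ∈ Ω, gridIndex ρ x ∈ S := fun x hx => by
    rw [← Finset.mem_coe, hS]
    exact mem_image_of_mem _ hx
  obtain ⟨D, hD⟩ := exists_finset_abs_sub_le (√(M / ρ ^ N)) hη
  classical
  refine ⟨Finset.univ.image fun (f : S → D) x =>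
    if hx : gridIndex ρ x ∈ S then (f ⟨gridIndex ρ x, hx⟩ : ℝ) else 0, fun g hg => ?_⟩
  have hgm := hTmeas g hg
  have hgM := hM g hg
  set W : EuclideanSpace ℝ (Fin N) × EuclideanSpace ℝ (Fin N) → ℝ≥0∞ :=
    fun p => ENNReal.ofReal ((g p.1 - g p.2) ^ 2 * K (p.1 - p.2)) with hW_def
  have hcell : ∀ n, ∃ y ∈ Q n, (∫⁻ x in Q n, ENNReal.ofReal ((g x - g y) ^ 2)) +
      ENNReal.ofReal δ * volume (Q n) * ENNReal.ofReal (g y ^ 2) ≤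
      ENNReal.ofReal δ * ((∫⁻ p in Q n ×ˢ Q n, W p) + ∫⁻ x in Q n, ENNReal.ofReal (g x ^ 2)) := by
    intro n
    refine exists_setLIntegral_sq_sub_add_le (hQm n) ?_ ?_ hgm ENNReal.ofReal_ne_top ?_
    · rw [hQvol]
      exact (ENNReal.ofReal_pos.2 (by positivity)).ne'
    · rw [hQvol]
      exact ENNReal.ofReal_ne_top
    · intro x hx y hy
      rw [hQvol, hW_def, ← ENNReal.ofReal_mul hδ.le, ← ENNReal.ofReal_mul (by positivity)]
      refine ENNReal.ofReal_le_ofReal ?_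
      rcases eq_or_ne x y with rfl | hxy
      · simp
      have hle : ‖x - y‖ ≤ ‖v‖ := by
        have := norm_sub_le_of_gridIndex_eq hρ (Eq.trans (b := n) hx (Eq.symm hy))
        rwa [hρ_def, mul_div_cancel₀ _ hN0.ne'] at this
      have hKle := hmono (x - y) v (sub_ne_zero.2 hxy) hv0 hle
      have h1 : 1 ≤ δ * ρ ^ N * K (x - y) := hkey.trans (by gcongr)
      calc (g x - g y) ^ 2 ≤ (g x - g y) ^ 2 * (δ * ρ ^ N * K (x - y)) :=
            le_mul_of_one_le_right (sq_nonneg _) h1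
        _ = _ := by ring
  choose y hyQ hy using hcell
  have hyB : ∀ n, |g (y n)| ≤ √(M / ρ ^ N) := by
    intro n
    refine Real.abs_le_sqrt ?_
    rw [le_div_iff₀ (by positivity)]
    have h1 := (le_add_self.trans (hy n)).trans (mul_le_mul_right ((add_le_add
      (setLIntegral_le_lintegral _ _) (setLIntegral_le_lintegral _ _)).trans hgM) _)
    rw [hQvol, ← ENNReal.ofReal_mul hδ.le, ← ENNReal.ofReal_mul (by positivity),
      ← ENNReal.ofReal_mul hδ.le, ENNReal.ofReal_le_ofReal_iff (by positivity)] at h1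
    refine le_of_mul_le_mul_left ?_ hδ
    linarith
  choose d hdD hd using fun n => hD (g (y n)) (hyB n)
  refine ⟨_, Finset.mem_image_of_mem _ (Finset.mem_univ fun n => ⟨d n, hdD n⟩), ?_⟩
  refine eLpNorm_two_lt_ofReal hε.le ?_
  have hcover : Ω = ⋃ n ∈ S, Q n ∩ Ω := by
    ext x
    simp only [mem_iUnion, mem_inter_iff, exists_prop, hQ_def]
    exact ⟨fun hx => ⟨_, hΩS x hx, rfl, hx⟩, fun ⟨_, _, _, hx⟩ => hx⟩
  have hQΩm : ∀ n ∈ S, MeasurableSet (Q n ∩ Ω) := fun n _ => (hQm n).inter hΩo.measurableSet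
  have hQΩd : Set.PairwiseDisjoint (S : Set (Fin N → ℤ)) fun n => Q n ∩ Ω := fun m _ n _ hmn =>
    (hQd hmn).mono inter_subset_left inter_subset_left
  set h : EuclideanSpace ℝ (Fin N) → ℝ := fun x =>
    if _ : gridIndex ρ x ∈ S then d (gridIndex ρ x) else 0 with h_def
  have hloc : ∀ n ∈ S, ∫⁻ x in Q n ∩ Ω, ENNReal.ofReal ((g x - h x) ^ 2) ≤
      2 * (ENNReal.ofReal δ *
        ((∫⁻ p in Q n ×ˢ Q n, W p) + ∫⁻ x in Q n, ENNReal.ofReal (g x ^ 2))) +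
      ENNReal.ofReal (2 * η ^ 2) * volume (Q n ∩ Ω) := by
    intro n hn
    calc ∫⁻ x in Q n ∩ Ω, ENNReal.ofReal ((g x - h x) ^ 2)
        ≤ ∫⁻ x in Q n ∩ Ω,
            (2 * ENNReal.ofReal ((g x - g (y n)) ^ 2) + ENNReal.ofReal (2 * η ^ 2)) := by
          refine setLIntegral_mono_ae' (hQΩm n hn) (.of_forall fun x hx => ?_)
          have hxn : gridIndex ρ x = n := hx.1
          have hhx : h x = d n := by simp [h_def, hxn, hn]
          rw [hhx, ← ENNReal.ofReal_ofNat 2, ← ENNReal.ofReal_mul zero_le_two,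
            ← ENNReal.ofReal_add (by positivity) (by positivity)]
          refine ENNReal.ofReal_le_ofReal ?_
          have h2 : (g (y n) - d n) ^ 2 ≤ η ^ 2 := sq_le_sq' (abs_le.1 (hd n)).1 (abs_le.1 (hd n)).2
          nlinarith [sq_nonneg ((g x - g (y n)) - (g (y n) - d n))]
      _ = 2 * (∫⁻ x in Q n ∩ Ω, ENNReal.ofReal ((g x - g (y n)) ^ 2)) +
            ENNReal.ofReal (2 * η ^ 2) * volume (Q n ∩ Ω) := by
          rw [lintegral_add_right _ measurable_const, lintegral_const_mul _ (by fun_prop),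
            setLIntegral_const]
      _ ≤ _ := by
          gcongr
          exact (lintegral_mono_set inter_subset_left).trans (le_self_add.trans (hy n))
  calc ∫⁻ x in Ω, ENNReal.ofReal ((g x - h x) ^ 2)
      = ∑ n ∈ S, ∫⁻ x in Q n ∩ Ω, ENNReal.ofReal ((g x - h x) ^ 2) := by
        rw [← lintegral_biUnion_finset hQΩd hQΩm, ← hcover]
    _ ≤ _ := Finset.sum_le_sum hloc
    _ = 2 * (ENNReal.ofReal δ * ((∑ n ∈ S, ∫⁻ p in Q n ×ˢ Q n, W p) +
          ∑ n ∈ S, ∫⁻ x in Q n, ENNReal.ofReal (g x ^ 2))) +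
        ENNReal.ofReal (2 * η ^ 2) * volume Ω := by
        rw [Finset.sum_add_distrib, ← Finset.mul_sum, ← Finset.mul_sum, ← Finset.mul_sum,
          Finset.sum_add_distrib, ← measure_biUnion_finset hQΩd hQΩm, ← hcover]
    _ ≤ 2 * (ENNReal.ofReal δ * ENNReal.ofReal M) +
        ENNReal.ofReal (2 * η ^ 2) * ENNReal.ofReal A := by
        rw [hA]
        gcongr
        refine le_trans (add_le_add ?_ ?_) hgM
        · exact Finset.sum_setLIntegral_le_lintegral
            (fun m _ n _ hmn => Set.disjoint_prod.2 (.inl (hQd hmn)))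
            (fun n _ => (hQm n).prod (hQm n)) _
        · exact Finset.sum_setLIntegral_le_lintegral (fun m _ n _ hmn => hQd hmn)
            (fun n _ => hQm n) _
    _ < ENNReal.ofReal (ε ^ 2) := by
        rw [← ENNReal.ofReal_ofNat 2, ← ENNReal.ofReal_mul hδ.le, ← ENNReal.ofReal_mul zero_le_two,
          ← ENNReal.ofReal_mul (by positivity), ← ENNReal.ofReal_add (by positivity) (by positivity)]
        refine (ENNReal.ofReal_lt_ofReal_iff (by positivity)).2 ?_
        have h1 : 2 * (δ * M) ≤ ε ^ 2 / 4 := by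
          rw [hδ_def, div_mul_eq_mul_div, mul_div_assoc', div_le_div_iff₀ (by positivity)
            (by positivity)]
          nlinarith [sq_nonneg ε]
        have h2 : 2 * η ^ 2 * A ≤ ε ^ 2 / 8 := by
          rw [hη_def, div_pow, mul_div_assoc', div_mul_eq_mul_div, div_le_div_iff₀ (by positivity)
            (by positivity)]
          nlinarith [sq_nonneg ε, mul_nonneg (sq_nonneg ε) (sq_nonneg A),
            mul_nonneg (sq_nonneg ε) hA0]
        nlinarith [pow_pos hε 2]
end

section
/- Let Ω ⊂ ℝ^N (N ≥ 2) be a bounded C² domain and K a kernel satisfying the integrability, symmetry, and radial monotonicity conditions with critical exponent s₀ ∈ (0,1]. Then for every p ∈ (2, 2N/(N−2s₀)) there exists a nontrivial u ∈ X₀ such that ∬_{ℝ^{2N}} (u(x)−u(y))(φ(x)−φ(y))K(x−y)dxdy = ∫_Ω |u|^{p−2}u φ dx for all φ ∈ X₀. -/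
open MeasureTheory Filter Topology Set
open scoped ENNReal

noncomputable def kernelEnergy (N : ℕ) (K g : EuclideanSpace ℝ (Fin N) → ℝ) : ℝ≥0∞ :=
  ∫⁻ x : EuclideanSpace ℝ (Fin N), ∫⁻ y : EuclideanSpace ℝ (Fin N),
    ENNReal.ofReal ((g x - g y) ^ 2 * K (x - y))

/-- Bounded sequences in a separable Hilbert space have weakly convergent subsequences. -/
theorem exists_subseq_tendsto_inner {H : Type*} [NormedAddCommGroup H] [InnerProductSpace ℝ H]
    [CompleteSpace H] [TopologicalSpace.SeparableSpace H] (x : ℕ → H) (C : ℝ)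
    (hx : ∀ n, ‖x n‖ ≤ C) :
    ∃ φ : ℕ → ℕ, StrictMono φ ∧ ∀ g : H, ∃ l : ℝ,
      Tendsto (fun n => inner ℝ (x (φ n)) g) atTop (𝓝 l) := by
  have hmem : ∀ n, StrongDual.toWeakDual (InnerProductSpace.toDual ℝ H (x n)) ∈
      WeakDual.toStrongDual ⁻¹' Metric.closedBall (0 : StrongDual ℝ H) C := by
    intro n
    simpa using hx n
  obtain ⟨a, -, φ, hφ, ha⟩ := WeakDual.isSeqCompact_closedBall ℝ H 0 C hmem
  refine ⟨φ, hφ, fun g => ⟨a g, ?_⟩⟩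
  have := ((WeakDual.eval_continuous g).tendsto a).comp ha
  exact this

theorem kernelEnergy_eq (N : ℕ) (K g : EuclideanSpace ℝ (Fin N) → ℝ) :
    kernelEnergy N K g = ∫⁻ x, ∫⁻ y, ENNReal.ofReal ((g x - g y) ^ 2) *
      ENNReal.ofReal (K (x - y)) := by
  unfold kernelEnergy
  simp_rw [ENNReal.ofReal_mul (sq_nonneg _)]

theorem kernelTail_lt_top {N : ℕ} {K : EuclideanSpace ℝ (Fin N) → ℝ}
    (hmeas : Measurable K) (hint : kernelIntegrable N K) {r : ℝ} (hr : 0 < r) :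
    kernelTail N K r < ⊤ := by
  unfold kernelTail
  set c : ℝ := min (r ^ 2) 1 with hc
  have hc0 : 0 < c := by positivity
  have hms : MeasurableSet {y : EuclideanSpace ℝ (Fin N) | r ≤ ‖y‖} :=
    measurableSet_le measurable_const measurable_norm
  have : ENNReal.ofReal c * ∫⁻ y in {y : EuclideanSpace ℝ (Fin N) | r ≤ ‖y‖},
      ENNReal.ofReal (K y) < ⊤ := by
    refine lt_of_le_of_lt ?_ hint
    rw [← lintegral_const_mul _ (by fun_prop)]
    refine le_trans ?_ (setLIntegral_le_lintegral {y : EuclideanSpace ℝ (Fin N) | r ≤ ‖y‖} _)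
    refine setLIntegral_mono' hms fun y hy => ?_
    rw [ENNReal.ofReal_mul (by positivity)]
    gcongr
    exact min_le_min_right _ (pow_le_pow_left₀ hr.le hy 2)
  by_contra h
  rw [not_lt, top_le_iff] at h
  rw [h, ENNReal.mul_top (by simpa using hc0)] at this
  exact lt_irrefl _ this

/-- Among sets of measure at most that of a ball, the complement of the ball minimises the mass of
a radially decreasing kernel. -/
theorem kernelTail_le_setLIntegral_compl {N : ℕ} (hN : 2 ≤ N)
    {K : EuclideanSpace ℝ (Fin N) → ℝ} (hmeas : Measurable K)
    (hmono : ∀ x y : EuclideanSpace ℝ (Fin N), x ≠ 0 → y ≠ 0 → ‖x‖ ≤ ‖y‖ → K y ≤ K x)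
    {A : Set (EuclideanSpace ℝ (Fin N))} (hA : MeasurableSet A) {r : ℝ} (hr : 0 < r)
    (hAr : volume A ≤ volume (Metric.ball (0 : EuclideanSpace ℝ (Fin N)) r))
    (x : EuclideanSpace ℝ (Fin N)) :
    kernelTail N K r ≤ ∫⁻ y in Aᶜ, ENNReal.ofReal (K (x - y)) := by
  have : Nonempty (Fin N) := ⟨⟨0, by omega⟩⟩
  set k : EuclideanSpace ℝ (Fin N) → ℝ≥0∞ := fun y => ENNReal.ofReal (K y) with hk
  have hkm : Measurable k := by fun_prop
  set A' : Set (EuclideanSpace ℝ (Fin N)) := (fun y => x - y) ⁻¹' A with hA'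
  have hA'm : MeasurableSet A' := hA.preimage (by fun_prop)
  have hvol : volume A' = volume A :=
    (Measure.measurePreserving_sub_left volume x).measure_preimage hA.nullMeasurableSet
  have hchange : ∫⁻ y in Aᶜ, k (x - y) = ∫⁻ z in A'ᶜ, k z := by
    rw [← lintegral_indicator hA.compl, ← lintegral_indicator hA'm.compl,
      ← lintegral_sub_left_eq_self _ x]
    refine lintegral_congr fun y => ?_
    simp only [indicator, mem_compl_iff, hA', mem_preimage, sub_sub_cancel]
    rfl
  set B : Set (EuclideanSpace ℝ (Fin N)) := Metric.ball 0 r with hB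
  have hBm : MeasurableSet B := measurableSet_ball
  have hBc : {y : EuclideanSpace ℝ (Fin N) | r ≤ ‖y‖} = Bᶜ := by
    ext y; simp [hB]
  obtain ⟨v, hv⟩ : ∃ v : EuclideanSpace ℝ (Fin N), ‖v‖ = r :=
    exists_norm_eq _ hr.le
  have hv0 : v ≠ 0 := by rintro rfl; simp at hv; linarith
  have hBfin : volume B ≠ ⊤ := measure_ball_lt_top.ne
  have hmeasle : volume (Bᶜ ∩ A') ≤ volume (B ∩ A'ᶜ) := by
    have h1 : volume (A' ∩ B) + volume (A' \ B) = volume A' := measure_inter_add_sdiff _ hBm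
    have h2 : volume (B ∩ A') + volume (B \ A') = volume B := measure_inter_add_sdiff _ hA'm
    have h3 : volume (A' ∩ B) ≠ ⊤ := measure_ne_top_of_subset inter_subset_right hBfin
    rw [inter_comm Bᶜ, ← sdiff_eq, ← sdiff_eq]
    rw [inter_comm] at h2
    refine (ENNReal.add_le_add_iff_left h3).1 ?_
    rw [h1, h2, hvol]
    exact hAr
  unfold kernelTail
  rw [hBc]
  change ∫⁻ y in Bᶜ, k y ≤ ∫⁻ y in Aᶜ, k (x - y)
  rw [hchange, ← lintegral_inter_add_sdiff k Bᶜ hA'm, ← lintegral_inter_add_sdiff k A'ᶜ hBm,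
    sdiff_eq, sdiff_eq, inter_comm A'ᶜ B, inter_comm A'ᶜ Bᶜ]
  gcongr 1
  calc ∫⁻ y in Bᶜ ∩ A', k y ≤ ∫⁻ _ in Bᶜ ∩ A', k v := by
        refine setLIntegral_mono' (hBm.compl.inter hA'm) fun y hy => ?_
        have hy' : r ≤ ‖y‖ := by simpa [hB] using hy.1
        exact ENNReal.ofReal_le_ofReal (hmono v y hv0
          (by rintro rfl; simp at hy'; linarith) (hv ▸ hy'))
    _ = k v * volume (Bᶜ ∩ A') := by simp
    _ ≤ k v * volume (B ∩ A'ᶜ) := by gcongr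
    _ = ∫⁻ _ in B ∩ A'ᶜ, k v := by simp
    _ ≤ ∫⁻ y in B ∩ A'ᶜ, k y := by
        refine setLIntegral_mono_ae hkm.aemeasurable ?_
        have : ∀ᵐ y : EuclideanSpace ℝ (Fin N), y ≠ 0 := by
          simp [ae_iff]
        filter_upwards [this] with y hy0 hy
        have hy' : ‖y‖ < r := by simpa [hB] using hy.1
        exact ENNReal.ofReal_le_ofReal (hmono y v hy0 hv0 (hv ▸ hy'.le))

theorem kernelTail_antitone (N : ℕ) (K : EuclideanSpace ℝ (Fin N) → ℝ) :
    Antitone (kernelTail N K) := fun _ _ h =>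
  lintegral_mono_set fun _ hy => h.trans hy

theorem kernelTail_pos {N : ℕ} (hN : 2 ≤ N) {K : EuclideanSpace ℝ (Fin N) → ℝ}
    (hmeas : Measurable K) (hpos : ∀ x : EuclideanSpace ℝ (Fin N), x ≠ 0 → 0 < K x)
    {r : ℝ} (hr : 0 < r) : 0 < kernelTail N K r := by
  have : Nonempty (Fin N) := ⟨⟨0, by omega⟩⟩
  obtain ⟨v, hv⟩ : ∃ v : EuclideanSpace ℝ (Fin N), ‖v‖ = r + 1 :=
    exists_norm_eq _ (by positivity)
  have hms : MeasurableSet {y : EuclideanSpace ℝ (Fin N) | r ≤ ‖y‖} :=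
    measurableSet_le measurable_const measurable_norm
  unfold kernelTail
  rw [setLIntegral_pos_iff (by fun_prop)]
  refine lt_of_lt_of_le (Metric.measure_ball_pos volume v one_pos) (measure_mono fun y hy => ?_)
  have hy' : r ≤ ‖y‖ := by
    have h1 : ‖v - y‖ < 1 := by simpa [dist_eq_norm, norm_sub_rev] using hy
    have := norm_sub_norm_le v y
    linarith
  refine ⟨?_, hy'⟩
  have : y ≠ 0 := by rintro rfl; simp at hy'; linarith
  simpa using hpos y this

/-- A power lower bound for the tail at small radii extends to all bounded radii. -/
theorem exists_rpow_le_kernelTail {N : ℕ} (hN : 2 ≤ N) {K : EuclideanSpace ℝ (Fin N) → ℝ}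
    (hmeas : Measurable K) (hpos : ∀ x : EuclideanSpace ℝ (Fin N), x ≠ 0 → 0 < K x)
    {s : ℝ} (hs : 0 ≤ s)
    (hlim : Tendsto (fun r : ℝ => ENNReal.ofReal (r ^ (2 * s)) * kernelTail N K r)
      (𝓝[>] (0 : ℝ)) (𝓝 ⊤)) {R : ℝ} (hR : 0 < R) :
    ∃ c : ℝ, 0 < c ∧ ∀ r, 0 < r → r ≤ R →
      ENNReal.ofReal (c * r ^ (-(2 * s))) ≤ kernelTail N K r := by
  have h1 := hlim.eventually (lt_mem_nhds (show (1 : ℝ≥0∞) < ⊤ by simp))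
  obtain ⟨d, hd, hdr⟩ := mem_nhdsGT_iff_exists_Ioo_subset.1 h1
  have hd : 0 < d := hd
  obtain ⟨t, ht0, ht⟩ : ∃ t : ℝ, 0 < t ∧ ENNReal.ofReal t ≤ kernelTail N K R := by
    obtain ⟨t, ht0, ht⟩ := ENNReal.lt_iff_exists_nnreal_btwn.1 (kernelTail_pos hN hmeas hpos hR)
    exact ⟨t, by exact_mod_cast ht0, by simpa using ht.le⟩
  refine ⟨min 1 (t * d ^ (2 * s)), by positivity, fun r hr hrR => ?_⟩
  by_cases hrd : r < d
  · have h2 : 1 < ENNReal.ofReal (r ^ (2 * s)) * kernelTail N K r := hdr ⟨hr, hrd⟩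
    calc ENNReal.ofReal (min 1 (t * d ^ (2 * s)) * r ^ (-(2 * s)))
        ≤ ENNReal.ofReal (r ^ (-(2 * s))) * 1 := by
          rw [mul_one]
          refine ENNReal.ofReal_le_ofReal ?_
          exact mul_le_of_le_one_left (by positivity) (min_le_left _ _)
      _ ≤ ENNReal.ofReal (r ^ (-(2 * s))) * (ENNReal.ofReal (r ^ (2 * s)) * kernelTail N K r) := by
          gcongr
      _ = kernelTail N K r := by
          rw [← mul_assoc, ← ENNReal.ofReal_mul (by positivity), ← Real.rpow_add hr]
          simp
  · refine le_trans ?_ (ht.trans (kernelTail_antitone N K hrR))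
    refine ENNReal.ofReal_le_ofReal ?_
    calc min 1 (t * d ^ (2 * s)) * r ^ (-(2 * s)) ≤ (t * d ^ (2 * s)) * d ^ (-(2 * s)) := by
          refine mul_le_mul (min_le_right _ _) ?_ (by positivity) (by positivity)
          exact Real.rpow_le_rpow_of_nonpos hd (not_lt.1 hrd) (by linarith)
      _ = t := by rw [mul_assoc, ← Real.rpow_add hd]; simp

/-- Every sublevel set of the energy is bounded in `L^q`. -/
def EnergyBounded (N : ℕ) (K : EuclideanSpace ℝ (Fin N) → ℝ)
    (Ω : Set (EuclideanSpace ℝ (Fin N))) (q : ℝ) : Prop :=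
  ∀ T : NNReal, ∃ C : NNReal, ∀ f : EuclideanSpace ℝ (Fin N) → ℝ, Measurable f →
    (∀ x ∉ Ω, f x = 0) → kernelEnergy N K f ≤ T → ∫⁻ x, ‖f x‖ₑ ^ q ≤ C

theorem ofReal_mul_kernelTail_le {N : ℕ} (hN : 2 ≤ N)
    {K : EuclideanSpace ℝ (Fin N) → ℝ} (hmeas : Measurable K)
    (hmono : ∀ x y : EuclideanSpace ℝ (Fin N), x ≠ 0 → y ≠ 0 → ‖x‖ ≤ ‖y‖ → K y ≤ K x)
    {A : Set (EuclideanSpace ℝ (Fin N))} (hA : MeasurableSet A) {r : ℝ} (hr : 0 < r)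
    (hAr : volume A ≤ volume (Metric.ball (0 : EuclideanSpace ℝ (Fin N)) r))
    {f : EuclideanSpace ℝ (Fin N) → ℝ} {x : EuclideanSpace ℝ (Fin N)} {b : ℝ}
    (hb : ∀ y ∉ A, b ≤ (f x - f y) ^ 2) :
    ENNReal.ofReal b * kernelTail N K r ≤
      ∫⁻ y, ENNReal.ofReal ((f x - f y) ^ 2) * ENNReal.ofReal (K (x - y)) := by
  calc ENNReal.ofReal b * kernelTail N K r
      ≤ ENNReal.ofReal b * ∫⁻ y in Aᶜ, ENNReal.ofReal (K (x - y)) := by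
        gcongr
        exact kernelTail_le_setLIntegral_compl hN hmeas hmono hA hr hAr x
    _ = ∫⁻ y in Aᶜ, ENNReal.ofReal b * ENNReal.ofReal (K (x - y)) := by
        rw [lintegral_const_mul _ (by fun_prop)]
    _ ≤ ∫⁻ y in Aᶜ, ENNReal.ofReal ((f x - f y) ^ 2) * ENNReal.ofReal (K (x - y)) := by
        refine setLIntegral_mono' hA.compl fun y hy => ?_
        gcongr
        exact hb y hy
    _ ≤ _ := setLIntegral_le_lintegral _ _

theorem enorm_rpow_two (a : ℝ) : ‖a‖ₑ ^ (2 : ℝ) = ENNReal.ofReal (a ^ 2) := by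
  rw [Real.enorm_eq_ofReal_abs, ENNReal.ofReal_rpow_of_nonneg (abs_nonneg _) (by norm_num)]
  simp

theorem exists_volume_le_ball {N : ℕ} {Ω : Set (EuclideanSpace ℝ (Fin N))}
    (hΩb : Bornology.IsBounded Ω) :
    ∃ R : ℝ, 0 < R ∧ volume Ω ≤ volume (Metric.ball (0 : EuclideanSpace ℝ (Fin N)) R) := by
  obtain ⟨R, hR0, hR⟩ := hΩb.subset_ball_lt 0 0
  exact ⟨R, hR0, measure_mono hR⟩

theorem energyBounded_two {N : ℕ} (hN : 2 ≤ N) {K : EuclideanSpace ℝ (Fin N) → ℝ}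
    (hmeas : Measurable K) (hpos : ∀ x : EuclideanSpace ℝ (Fin N), x ≠ 0 → 0 < K x)
    (hint : kernelIntegrable N K)
    (hmono : ∀ x y : EuclideanSpace ℝ (Fin N), x ≠ 0 → y ≠ 0 → ‖x‖ ≤ ‖y‖ → K y ≤ K x)
    {Ω : Set (EuclideanSpace ℝ (Fin N))} (hΩo : IsOpen Ω) (hΩb : Bornology.IsBounded Ω) :
    EnergyBounded N K Ω 2 := by
  intro T
  obtain ⟨R, hR, hvol⟩ := exists_volume_le_ball hΩb
  have htail := kernelTail_pos hN hmeas hpos hR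
  have hfin : (T : ℝ≥0∞) / kernelTail N K R ≠ ⊤ :=
    ENNReal.div_ne_top (by simp) htail.ne'
  refine ⟨((T : ℝ≥0∞) / kernelTail N K R).toNNReal, fun f hf hf0 hE => ?_⟩
  rw [ENNReal.coe_toNNReal hfin]
  rw [ENNReal.le_div_iff_mul_le (Or.inl htail.ne')
    (Or.inl (kernelTail_lt_top hmeas hint hR).ne),
    ← lintegral_mul_const _ (by fun_prop)]
  refine le_trans ?_ hE
  rw [kernelEnergy_eq]
  refine lintegral_mono fun x => ?_
  rw [enorm_rpow_two]
  by_cases hx : x ∈ Ω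
  · refine ofReal_mul_kernelTail_le hN hmeas hmono hΩo.measurableSet hR hvol fun y hy => ?_
    simp [hf0 y hy]
  · simp [hf0 x hx]

theorem EnergyBounded.gain {N : ℕ} (hN : 2 ≤ N) {K : EuclideanSpace ℝ (Fin N) → ℝ}
    (hmeas : Measurable K) (hpos : ∀ x : EuclideanSpace ℝ (Fin N), x ≠ 0 → 0 < K x)
    (hmono : ∀ x y : EuclideanSpace ℝ (Fin N), x ≠ 0 → y ≠ 0 → ‖x‖ ≤ ‖y‖ → K y ≤ K x)
    {Ω : Set (EuclideanSpace ℝ (Fin N))} (hΩb : Bornology.IsBounded Ω)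
    {s : ℝ} (hs : 0 ≤ s)
    (hlim : Tendsto (fun r : ℝ => ENNReal.ofReal (r ^ (2 * s)) * kernelTail N K r)
      (𝓝[>] (0 : ℝ)) (𝓝 ⊤)) {q : ℝ} (hq : 0 < q) (h : EnergyBounded N K Ω q) :
    EnergyBounded N K Ω (2 + 2 * s / N * q) := by
  intro T
  have : Nonempty (Fin N) := ⟨⟨0, by omega⟩⟩
  have hN0 : (0 : ℝ) < N := by positivity
  obtain ⟨C, hC⟩ := h T
  obtain ⟨R, hR, hvol⟩ := exists_volume_le_ball hΩb
  obtain ⟨c, hc, hctail⟩ := exists_rpow_le_kernelTail hN hmeas hpos hs hlim hR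
  set ω : ℝ := (volume (Metric.ball (0 : EuclideanSpace ℝ (Fin N)) 1)).toReal with hω
  have hω0 : 0 < ω := ENNReal.toReal_pos (Metric.measure_ball_pos volume _ one_pos).ne'
    measure_ball_lt_top.ne
  have hball : ∀ r : ℝ, 0 < r → volume (Metric.ball (0 : EuclideanSpace ℝ (Fin N)) r) =
      ENNReal.ofReal (r ^ N * ω) := by
    intro r hr
    rw [Measure.addHaar_ball_of_pos volume _ hr, finrank_euclideanSpace_fin,
      ENNReal.ofReal_mul (by positivity), hω, ENNReal.ofReal_toReal measure_ball_lt_top.ne]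
  set D : ℝ := (C + 1) * 2 ^ q / ω with hD
  have hD0 : 0 < D := by positivity
  set c' : ℝ := c * D ^ (-(2 * s / N)) / 4 with hc'
  have hc'0 : 0 < c' := by positivity
  refine ⟨T / c'.toNNReal, fun f hf hf0 hE => ?_⟩
  have hY := hC f hf hf0 hE
  set θ : ℝ := 2 * s / N with hθ
  have hθ0 : 0 ≤ θ := by positivity
  have hpt : ∀ x, ENNReal.ofReal c' * ‖f x‖ₑ ^ (2 + θ * q) ≤
      ∫⁻ y, ENNReal.ofReal ((f x - f y) ^ 2) * ENNReal.ofReal (K (x - y)) := by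
    intro x
    by_cases hx : f x = 0
    · have : 0 < 2 + θ * q := by positivity
      simp [hx, ENNReal.zero_rpow_of_pos this]
    set a : ℝ := |f x| with ha
    have ha0 : 0 < a := abs_pos.2 hx
    set A : Set (EuclideanSpace ℝ (Fin N)) := {y | a / 2 < |f y|} with hA
    have hAm : MeasurableSet A := measurableSet_lt measurable_const (by fun_prop)
    have hAΩ : A ⊆ Ω := by
      intro y hy
      by_contra hyΩ
      have hy' : a / 2 < |f y| := hy
      rw [hf0 y hyΩ, abs_zero] at hy'
      linarith
    have hAC : volume A ≤ ENNReal.ofReal ((C + 1) * 2 ^ q / a ^ q) := by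
      have h1 : ENNReal.ofReal ((a / 2) ^ q) * volume A ≤ C := by
        refine le_trans ?_ hY
        refine le_trans ?_ (mul_meas_ge_le_lintegral (by fun_prop)
          (ENNReal.ofReal ((a / 2) ^ q)))
        refine mul_le_mul_right (measure_mono fun y hy => ?_) _
        have hy' : a / 2 < |f y| := hy
        rw [mem_ofPred_eq, Real.enorm_eq_ofReal_abs,
          ENNReal.ofReal_rpow_of_nonneg (abs_nonneg _) hq.le]
        exact ENNReal.ofReal_le_ofReal (Real.rpow_le_rpow (by positivity) hy'.le hq.le)
      have h2 : 0 < (a / 2) ^ q := by positivity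
      have h3 : (C + 1) * 2 ^ q / a ^ q = (C + 1) / (a / 2) ^ q := by
        rw [Real.div_rpow ha0.le (by norm_num)]
        field_simp
      rw [h3, ENNReal.ofReal_div_of_pos h2,
        ENNReal.le_div_iff_mul_le (Or.inl (by simpa using h2)) (Or.inl (by simp)), mul_comm]
      refine h1.trans ?_
      rw [← ENNReal.ofReal_coe_nnreal]
      exact ENNReal.ofReal_le_ofReal (by linarith)
    set ρ₀ : ℝ := (D / a ^ q) ^ (1 / (N : ℝ)) with hρ₀
    have hρ₀0 : 0 < ρ₀ := by positivity
    set ρ : ℝ := min R ρ₀ with hρ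
    have hρ0 : 0 < ρ := lt_min hR hρ₀0
    have hAρ : volume A ≤ volume (Metric.ball (0 : EuclideanSpace ℝ (Fin N)) ρ) := by
      rcases min_choice R ρ₀ with h' | h'
      · rw [hρ, h']; exact (measure_mono hAΩ).trans hvol
      · rw [hρ, h', hball _ hρ₀0]
        refine hAC.trans (ENNReal.ofReal_le_ofReal (le_of_eq ?_))
        rw [hρ₀, ← Real.rpow_natCast, ← Real.rpow_mul (by positivity), one_div,
          inv_mul_cancel₀ hN0.ne', Real.rpow_one, hD]
        field_simp
    have hkey := ofReal_mul_kernelTail_le (K := K) (f := f) (x := x) (b := a ^ 2 / 4)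
      hN hmeas hmono hAm hρ0 hAρ ?_
    · refine le_trans ?_ hkey
      refine le_trans ?_ (mul_le_mul_right (hctail ρ hρ0 (min_le_left _ _)) _)
      rw [Real.enorm_eq_ofReal_abs, ← ha, ENNReal.ofReal_rpow_of_pos ha0,
        ← ENNReal.ofReal_mul hc'0.le, ← ENNReal.ofReal_mul (by positivity)]
      refine ENNReal.ofReal_le_ofReal ?_
      have h5 : ρ₀ ^ (-(2 * s)) ≤ ρ ^ (-(2 * s)) :=
        Real.rpow_le_rpow_of_nonpos hρ0 (min_le_right _ _) (by linarith)
      have h6 : ρ₀ ^ (-(2 * s)) = D ^ (-θ) * a ^ (θ * q) := by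
        rw [hρ₀, ← Real.rpow_mul (by positivity),
          show 1 / (N : ℝ) * (-(2 * s)) = -θ by rw [hθ]; ring,
          Real.div_rpow hD0.le (by positivity), ← Real.rpow_mul ha0.le, mul_neg,
          Real.rpow_neg ha0.le, div_inv_eq_mul, mul_comm q]
      calc c' * a ^ (2 + θ * q) = a ^ 2 / 4 * (c * ρ₀ ^ (-(2 * s))) := by
            rw [h6, hc', Real.rpow_add ha0, Real.rpow_two]; ring
        _ ≤ _ := by gcongr
    · intro y hy
      have hy' : |f y| ≤ a / 2 := not_lt.1 hy
      have h7 : a / 2 ≤ |f x - f y| := by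
        have := abs_sub_abs_le_abs_sub (f x) (f y)
        linarith
      calc a ^ 2 / 4 = (a / 2) ^ 2 := by ring
        _ ≤ |f x - f y| ^ 2 := by gcongr
        _ = _ := sq_abs _
  have hcc : ((T / c'.toNNReal : NNReal) : ℝ≥0∞) = T / ENNReal.ofReal c' := by
    rw [ENNReal.coe_div (by simpa using hc'0)]
    rfl
  rw [hcc, ENNReal.le_div_iff_mul_le (Or.inl (by simpa using hc'0)) (Or.inl (by simp)),
    mul_comm, ← lintegral_const_mul _ (by fun_prop)]
  refine le_trans (lintegral_mono hpt) ?_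
  rw [← kernelEnergy_eq]
  exact hE

theorem EnergyBounded.mono {N : ℕ} {K : EuclideanSpace ℝ (Fin N) → ℝ}
    {Ω : Set (EuclideanSpace ℝ (Fin N))} {p q : ℝ} (h2 : EnergyBounded N K Ω 2)
    (hq : EnergyBounded N K Ω q) (hp2 : 2 ≤ p) (hpq : p ≤ q) : EnergyBounded N K Ω p := by
  intro T
  obtain ⟨C, hC⟩ := h2 T
  obtain ⟨D, hD⟩ := hq T
  refine ⟨C + D, fun f hf hf0 hE => ?_⟩
  calc ∫⁻ x, ‖f x‖ₑ ^ p ≤ ∫⁻ x, (‖f x‖ₑ ^ (2 : ℝ) + ‖f x‖ₑ ^ q) := by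
        refine lintegral_mono fun x => ?_
        rcases le_total ‖f x‖ₑ 1 with h | h
        · exact (ENNReal.rpow_le_rpow_of_exponent_ge h hp2).trans le_self_add
        · exact (ENNReal.rpow_le_rpow_of_exponent_le h hpq).trans le_add_self
    _ = (∫⁻ x, ‖f x‖ₑ ^ (2 : ℝ)) + ∫⁻ x, ‖f x‖ₑ ^ q := lintegral_add_left (by fun_prop) _
    _ ≤ C + D := add_le_add (hC f hf hf0 hE) (hD f hf hf0 hE)
    _ = _ := by simp

/-- The fractional Sobolev inequality: all subcritical exponents are reached by iterating the
integrability gain. -/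
theorem energyBounded_of_subcritical {N : ℕ} (hN : 2 ≤ N) {K : EuclideanSpace ℝ (Fin N) → ℝ}
    (hmeas : Measurable K) (hpos : ∀ x : EuclideanSpace ℝ (Fin N), x ≠ 0 → 0 < K x)
    (hint : kernelIntegrable N K)
    (hmono : ∀ x y : EuclideanSpace ℝ (Fin N), x ≠ 0 → y ≠ 0 → ‖x‖ ≤ ‖y‖ → K y ≤ K x)
    {Ω : Set (EuclideanSpace ℝ (Fin N))} (hΩo : IsOpen Ω) (hΩb : Bornology.IsBounded Ω)
    {s : ℝ} (hs : 0 ≤ s)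
    (hlim : Tendsto (fun r : ℝ => ENNReal.ofReal (r ^ (2 * s)) * kernelTail N K r)
      (𝓝[>] (0 : ℝ)) (𝓝 ⊤)) (hsN : 2 * s ≤ N) {q : ℝ} (hq2 : 2 ≤ q)
    (hqs : (1 - 2 * s / N) * q < 2) : EnergyBounded N K Ω q := by
  have h2 := energyBounded_two hN hmeas hpos hint hmono hΩo hΩb
  set θ : ℝ := 2 * s / N with hθ
  have hθ0 : 0 ≤ θ := by positivity
  have hθ1 : θ ≤ 1 := div_le_one_of_le₀ hsN (by positivity)
  set ε : ℝ := 2 - (1 - θ) * q with hε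
  have hε0 : 0 < ε := by linarith
  have key : ∀ n : ℕ, ∃ r : ℝ, EnergyBounded N K Ω r ∧ 2 ≤ r ∧ min q (2 + n * ε) ≤ r := by
    intro n
    induction n with
    | zero => exact ⟨2, h2, le_rfl, by simp⟩
    | succ n ih =>
      obtain ⟨r, hr, hr2, hrn⟩ := ih
      rcases le_total q r with hqr | hqr
      · exact ⟨r, hr, hr2, (min_le_left _ _).trans hqr⟩
      · refine ⟨2 + θ * r, hr.gain hN hmeas hpos hmono hΩb hs hlim (by linarith), ?_, ?_⟩
        · nlinarith
        · have h1 : r + ε ≤ 2 + θ * r := by nlinarith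
          push_cast
          rcases min_le_iff.1 hrn with h' | h'
          · exact (min_le_left _ _).trans (by linarith)
          · exact (min_le_right _ _).trans (by linarith)
  obtain ⟨n, hn⟩ := exists_nat_gt ((q - 2) / ε)
  obtain ⟨r, hr, -, hrn⟩ := key n
  refine h2.mono hr hq2 (le_trans (le_min le_rfl ?_) hrn)
  rw [div_lt_iff₀ hε0] at hn
  linarith

theorem kernelEnergy_eq_lintegral_prod {N : ℕ} {K f : EuclideanSpace ℝ (Fin N) → ℝ}
    (hmeas : Measurable K) (hf : Measurable f) :
    kernelEnergy N K f = ∫⁻ p : EuclideanSpace ℝ (Fin N) × EuclideanSpace ℝ (Fin N),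
      ENNReal.ofReal ((f p.1 - f p.2) ^ 2) * ENNReal.ofReal (K (p.1 - p.2)) := by
  rw [kernelEnergy_eq, Measure.volume_eq_prod, lintegral_prod _ (by fun_prop)]

theorem kernelEnergy_sub_le {N : ℕ} {K f g : EuclideanSpace ℝ (Fin N) → ℝ}
    (hmeas : Measurable K) (hf : Measurable f) (hg : Measurable g) :
    kernelEnergy N K (f - g) ≤ 2 * kernelEnergy N K f + 2 * kernelEnergy N K g := by
  rw [kernelEnergy_eq_lintegral_prod hmeas hf, kernelEnergy_eq_lintegral_prod hmeas hg,
    kernelEnergy_eq_lintegral_prod hmeas (hf.sub hg), ← lintegral_const_mul _ (by fun_prop),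
    ← lintegral_const_mul _ (by fun_prop), ← lintegral_add_left (by fun_prop)]
  refine lintegral_mono fun p => ?_
  rw [← mul_assoc, ← mul_assoc, ← add_mul]
  gcongr
  rw [← ENNReal.ofReal_ofNat 2, ← ENNReal.ofReal_mul (by norm_num),
    ← ENNReal.ofReal_mul (by norm_num), ← ENNReal.ofReal_add (by positivity) (by positivity)]
  refine ENNReal.ofReal_le_ofReal ?_
  simp only [Pi.sub_apply]
  nlinarith [sq_nonneg ((f p.1 - f p.2) + (g p.1 - g p.2))]

theorem kernelEnergy_const_mul {N : ℕ} {K f : EuclideanSpace ℝ (Fin N) → ℝ}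
    (hmeas : Measurable K) (hf : Measurable f) (a : ℝ) :
    kernelEnergy N K (fun x => a * f x) = ENNReal.ofReal (a ^ 2) * kernelEnergy N K f := by
  rw [kernelEnergy_eq_lintegral_prod hmeas hf,
    kernelEnergy_eq_lintegral_prod hmeas (hf.const_mul a), ← lintegral_const_mul _ (by fun_prop)]
  refine lintegral_congr fun p => ?_
  rw [← mul_assoc, ← ENNReal.ofReal_mul (sq_nonneg a)]
  congr 2
  ring

/-- Lower semicontinuity of the energy under almost everywhere convergence. -/
theorem kernelEnergy_le_of_tendsto_ae {N : ℕ} {K : EuclideanSpace ℝ (Fin N) → ℝ}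
    (hmeas : Measurable K) {f : ℕ → EuclideanSpace ℝ (Fin N) → ℝ}
    {u : EuclideanSpace ℝ (Fin N) → ℝ} (hf : ∀ n, Measurable (f n)) (hu : Measurable u)
    (hlim : ∀ᵐ x, Tendsto (fun n => f n x) atTop (𝓝 (u x))) {T : ℝ≥0∞}
    (hT : ∀ n, kernelEnergy N K (f n) ≤ T) : kernelEnergy N K u ≤ T := by
  have h1 : ∀ᵐ p : EuclideanSpace ℝ (Fin N) × EuclideanSpace ℝ (Fin N),
      Tendsto (fun n => f n p.1) atTop (𝓝 (u p.1)) := by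
    rw [Measure.volume_eq_prod]; exact Measure.quasiMeasurePreserving_fst.ae hlim
  have h2 : ∀ᵐ p : EuclideanSpace ℝ (Fin N) × EuclideanSpace ℝ (Fin N),
      Tendsto (fun n => f n p.2) atTop (𝓝 (u p.2)) := by
    rw [Measure.volume_eq_prod]; exact Measure.quasiMeasurePreserving_snd.ae hlim
  rw [kernelEnergy_eq_lintegral_prod hmeas hu]
  calc _ = ∫⁻ p : EuclideanSpace ℝ (Fin N) × EuclideanSpace ℝ (Fin N), liminf (fun n =>
        ENNReal.ofReal ((f n p.1 - f n p.2) ^ 2) * ENNReal.ofReal (K (p.1 - p.2))) atTop := by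
        refine lintegral_congr_ae ?_
        filter_upwards [h1, h2] with p hp1 hp2
        refine (Tendsto.liminf_eq ?_).symm
        exact ENNReal.Tendsto.mul_const (ENNReal.tendsto_ofReal ((hp1.sub hp2).pow 2))
          (Or.inr ENNReal.ofReal_ne_top)
    _ ≤ _ := lintegral_liminf_le fun n => by fun_prop
    _ ≤ liminf (fun _ : ℕ => T) atTop := by
        refine liminf_le_liminf (Eventually.of_forall fun n => ?_)
        rw [← kernelEnergy_eq_lintegral_prod hmeas (hf n)]
        exact hT n
    _ = T := by simp

/-- The kernel with its singularity at the origin cut out. -/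
noncomputable def truncKernel (N : ℕ) (K : EuclideanSpace ℝ (Fin N) → ℝ) (r : ℝ) :
    EuclideanSpace ℝ (Fin N) → ℝ :=
  {y : EuclideanSpace ℝ (Fin N) | r ≤ ‖y‖}.indicator K

section truncKernel

variable {N : ℕ} {K : EuclideanSpace ℝ (Fin N) → ℝ} {r : ℝ}

theorem measurable_truncKernel (hmeas : Measurable K) : Measurable (truncKernel N K r) :=
  hmeas.indicator (measurableSet_le measurable_const measurable_norm)

theorem truncKernel_nonneg (hpos : ∀ x : EuclideanSpace ℝ (Fin N), x ≠ 0 → 0 < K x)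
    (hr : 0 < r) (x : EuclideanSpace ℝ (Fin N)) : 0 ≤ truncKernel N K r x := by
  refine indicator_nonneg (fun y (hy : r ≤ ‖y‖) => (hpos y ?_).le) x
  rintro rfl
  simp at hy
  linarith

theorem lintegral_truncKernel :
    ∫⁻ x, ENNReal.ofReal (truncKernel N K r x) = kernelTail N K r := by
  unfold kernelTail
  rw [← lintegral_indicator (measurableSet_le measurable_const measurable_norm)]
  refine lintegral_congr fun x => ?_
  unfold truncKernel
  by_cases hx : x ∈ {y : EuclideanSpace ℝ (Fin N) | r ≤ ‖y‖}
  · rw [indicator_of_mem hx, indicator_of_mem hx]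
  · rw [indicator_of_notMem hx, indicator_of_notMem hx, ENNReal.ofReal_zero]

theorem ofReal_truncKernel_le (x : EuclideanSpace ℝ (Fin N)) :
    ENNReal.ofReal (truncKernel N K r x) ≤ ENNReal.ofReal (K x) := by
  unfold truncKernel
  by_cases hx : x ∈ {y : EuclideanSpace ℝ (Fin N) | r ≤ ‖y‖}
  · rw [indicator_of_mem hx]
  · rw [indicator_of_notMem hx]; simp

theorem integrable_truncKernel (hmeas : Measurable K)
    (hpos : ∀ x : EuclideanSpace ℝ (Fin N), x ≠ 0 → 0 < K x) (hint : kernelIntegrable N K)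
    (hr : 0 < r) : Integrable (truncKernel N K r) := by
  refine ⟨(measurable_truncKernel hmeas).aestronglyMeasurable, ?_⟩
  rw [hasFiniteIntegral_iff_ofReal (Eventually.of_forall (truncKernel_nonneg hpos hr)),
    lintegral_truncKernel]
  exact kernelTail_lt_top hmeas hint hr

theorem integral_truncKernel (hmeas : Measurable K)
    (hpos : ∀ x : EuclideanSpace ℝ (Fin N), x ≠ 0 → 0 < K x) (hr : 0 < r) :
    ∫ x, truncKernel N K r x = (kernelTail N K r).toReal := by
  rw [integral_eq_lintegral_of_nonneg_ae (Eventually.of_forall (truncKernel_nonneg hpos hr))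
    (measurable_truncKernel hmeas).aestronglyMeasurable, lintegral_truncKernel]

theorem exists_truncKernel_le (hN : 2 ≤ N)
    (hpos : ∀ x : EuclideanSpace ℝ (Fin N), x ≠ 0 → 0 < K x)
    (hmono : ∀ x y : EuclideanSpace ℝ (Fin N), x ≠ 0 → y ≠ 0 → ‖x‖ ≤ ‖y‖ → K y ≤ K x)
    (hr : 0 < r) : ∃ b : ℝ, ∀ x, truncKernel N K r x ≤ b := by
  have : Nonempty (Fin N) := ⟨⟨0, by omega⟩⟩
  obtain ⟨v, hv⟩ : ∃ v : EuclideanSpace ℝ (Fin N), ‖v‖ = r := exists_norm_eq _ hr.le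
  have hv0 : v ≠ 0 := by rintro rfl; simp at hv; linarith
  refine ⟨K v, fun x => indicator_le' (fun y (hy : r ≤ ‖y‖) => ?_) (fun _ _ => (hpos v hv0).le) x⟩
  refine hmono v y hv0 ?_ (hv ▸ hy)
  rintro rfl
  simp at hy
  linarith

theorem memLp_truncKernel (hN : 2 ≤ N) (hmeas : Measurable K)
    (hpos : ∀ x : EuclideanSpace ℝ (Fin N), x ≠ 0 → 0 < K x) (hint : kernelIntegrable N K)
    (hmono : ∀ x y : EuclideanSpace ℝ (Fin N), x ≠ 0 → y ≠ 0 → ‖x‖ ≤ ‖y‖ → K y ≤ K x)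
    (hr : 0 < r) : MemLp (truncKernel N K r) 2 := by
  obtain ⟨b, hb⟩ := exists_truncKernel_le hN hpos hmono hr
  rw [memLp_two_iff_integrable_sq (measurable_truncKernel hmeas).aestronglyMeasurable]
  have := (integrable_truncKernel hmeas hpos hint hr).bdd_mul (c := b)
    (measurable_truncKernel hmeas).aestronglyMeasurable (Eventually.of_forall fun x => by
      rw [Real.norm_of_nonneg (truncKernel_nonneg hpos hr x)]; exact hb x)
  simpa only [sq] using this

/-- Up to the energy, a function is controlled in `L²` by its convolution with the truncated
kernel. -/
theorem lintegral_sq_mul_kernelTail_le (hN : 2 ≤ N) (hmeas : Measurable K)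
    (hpos : ∀ x : EuclideanSpace ℝ (Fin N), x ≠ 0 → 0 < K x) (hint : kernelIntegrable N K)
    (hmono : ∀ x y : EuclideanSpace ℝ (Fin N), x ≠ 0 → y ≠ 0 → ‖x‖ ≤ ‖y‖ → K y ≤ K x)
    (hr : 0 < r) {Ω : Set (EuclideanSpace ℝ (Fin N))} {f : EuclideanSpace ℝ (Fin N) → ℝ}
    (hf : Measurable f) (hf0 : ∀ x ∉ Ω, f x = 0) (hf2 : MemLp f 2) :
    (∫⁻ x, ENNReal.ofReal (f x ^ 2)) * kernelTail N K r ≤ 2 * kernelEnergy N K f +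
      ENNReal.ofReal (4 / (kernelTail N K r).toReal) *
        ∫⁻ x in Ω, ENNReal.ofReal ((∫ y, truncKernel N K r (x - y) * f y) ^ 2) := by
  set k := truncKernel N K r with hk
  set T := (kernelTail N K r).toReal with hT
  have hTfin := (kernelTail_lt_top hmeas hint hr).ne
  have hT0 : 0 < T := ENNReal.toReal_pos (kernelTail_pos hN hmeas hpos hr).ne' hTfin
  have hkm : Measurable k := measurable_truncKernel hmeas
  have hk0 := truncKernel_nonneg hpos hr
  obtain ⟨b, hb⟩ := exists_truncKernel_le hN hpos hmono hr
  have hpt : ∀ x, ENNReal.ofReal (f x ^ 2) * kernelTail N K r ≤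
      2 * (∫⁻ y, ENNReal.ofReal ((f x - f y) ^ 2) * ENNReal.ofReal (K (x - y))) +
        ENNReal.ofReal (4 / T) * ENNReal.ofReal ((∫ y, k (x - y) * f y) ^ 2) := by
    intro x
    set c := ∫ y, k (x - y) * f y with hc
    have hkL2 : MemLp (fun y => k (x - y)) 2 :=
      (memLp_truncKernel hN hmeas hpos hint hmono hr).comp_measurePreserving
        (Measure.measurePreserving_sub_left volume x)
    have hk1 : Integrable (fun y => k (x - y)) :=
      (integrable_truncKernel hmeas hpos hint hr).comp_sub_left x
    have hkf : Integrable (fun y => k (x - y) * f y) := hkL2.integrable_mul hf2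
    have hkff : Integrable (fun y => k (x - y) * f y ^ 2) :=
      hf2.integrable_sq.bdd_mul (c := b) hk1.aestronglyMeasurable (Eventually.of_forall fun y => by
        rw [Real.norm_of_nonneg (hk0 _)]; exact hb _)
    have hD : Integrable (fun y => (f x - f y) ^ 2 * k (x - y)) := by
      have := ((hk1.const_mul (f x ^ 2)).sub (hkf.const_mul (2 * f x))).add hkff
      refine this.congr (Eventually.of_forall fun y => ?_)
      simp only [Pi.add_apply, Pi.sub_apply]
      ring
    have h1 : f x ^ 2 * T ≤ (∫ y, (f x - f y) ^ 2 * k (x - y)) + 2 * f x * c := by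
      have hTk : T = ∫ y, k (x - y) := by
        rw [integral_sub_left_eq_self k volume x, hk, integral_truncKernel hmeas hpos hr]
      rw [hTk, hc, ← integral_const_mul, ← integral_const_mul, ← integral_add hD
        (hkf.const_mul _)]
      refine integral_mono (hk1.const_mul _) (hD.add (hkf.const_mul _)) fun y => ?_
      have := mul_nonneg (sq_nonneg (f y)) (hk0 (x - y))
      nlinarith
    have h2 : f x ^ 2 * T ≤ 2 * (∫ y, (f x - f y) ^ 2 * k (x - y)) + 4 / T * c ^ 2 := by
      have h3 : 2 * f x * c ≤ f x ^ 2 * T / 2 + 2 / T * c ^ 2 := by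
        have : 0 ≤ (f x * T - 2 * c) ^ 2 / (2 * T) := by positivity
        have h4 : (f x * T - 2 * c) ^ 2 / (2 * T) =
            f x ^ 2 * T / 2 + 2 / T * c ^ 2 - 2 * f x * c := by
          field_simp; ring
        linarith
      have h5 : 4 / T * c ^ 2 = 2 * (2 / T * c ^ 2) := by ring
      linarith
    have hD0 : ∀ y, 0 ≤ (f x - f y) ^ 2 * k (x - y) := fun y => mul_nonneg (sq_nonneg _) (hk0 _)
    calc ENNReal.ofReal (f x ^ 2) * kernelTail N K r = ENNReal.ofReal (f x ^ 2 * T) := by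
          rw [ENNReal.ofReal_mul (by positivity), hT, ENNReal.ofReal_toReal hTfin]
      _ ≤ _ := ENNReal.ofReal_le_ofReal h2
      _ = 2 * ENNReal.ofReal (∫ y, (f x - f y) ^ 2 * k (x - y)) +
          ENNReal.ofReal (4 / T) * ENNReal.ofReal (c ^ 2) := by
          rw [ENNReal.ofReal_add (mul_nonneg (by norm_num) (integral_nonneg hD0)) (by positivity),
            ENNReal.ofReal_mul (by norm_num), ENNReal.ofReal_mul (by positivity),
            ENNReal.ofReal_ofNat]
      _ ≤ _ := by
          rw [ofReal_integral_eq_lintegral_ofReal hD (Eventually.of_forall hD0)]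
          gcongr with y
          rw [ENNReal.ofReal_mul (sq_nonneg _)]
          exact mul_le_mul_right (ofReal_truncKernel_le _) _
  have hcm : Measurable (fun x => ∫ y, k (x - y) * f y) := by
    refine StronglyMeasurable.measurable ?_
    refine StronglyMeasurable.integral_prod_right (f := fun x y => k (x - y) * f y) ?_
    exact Measurable.stronglyMeasurable (by fun_prop)
  have hem : Measurable (fun x =>
      ∫⁻ y, ENNReal.ofReal ((f x - f y) ^ 2) * ENNReal.ofReal (K (x - y))) := by
    refine Measurable.lintegral_prod_right (f := fun x y =>
      ENNReal.ofReal ((f x - f y) ^ 2) * ENNReal.ofReal (K (x - y))) ?_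
    fun_prop
  have hsupp : ∫⁻ x, ENNReal.ofReal (f x ^ 2) = ∫⁻ x in Ω, ENNReal.ofReal (f x ^ 2) := by
    refine (setLIntegral_eq_of_support_subset fun x hx => ?_).symm
    by_contra h
    simp [hf0 x h] at hx
  rw [hsupp, ← lintegral_mul_const _ (by fun_prop), ← lintegral_const_mul _ (by fun_prop)]
  calc _ ≤ _ := lintegral_mono hpt
    _ = _ := lintegral_add_left (by fun_prop) _
    _ ≤ _ := by
      rw [lintegral_const_mul _ hem, kernelEnergy_eq]
      gcongr
      exact Measure.restrict_le_self

end truncKernel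

theorem EnergyBounded.memLp {N : ℕ} {K : EuclideanSpace ℝ (Fin N) → ℝ}
    {Ω : Set (EuclideanSpace ℝ (Fin N))} {q : ℝ} (hq : 0 < q) (h : EnergyBounded N K Ω q)
    {f : EuclideanSpace ℝ (Fin N) → ℝ} (hf : Measurable f) (hf0 : ∀ x ∉ Ω, f x = 0)
    (hE : kernelEnergy N K f < ⊤) : MemLp f (ENNReal.ofReal q) := by
  refine ⟨hf.aestronglyMeasurable, ?_⟩
  rw [eLpNorm_lt_top_iff_lintegral_rpow_enorm_lt_top (by simpa using hq) ENNReal.ofReal_ne_top,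
    ENNReal.toReal_ofReal hq.le]
  obtain ⟨C, hC⟩ := h (kernelEnergy N K f).toNNReal
  refine (hC f hf hf0 ?_).trans_lt (by simp)
  rw [ENNReal.coe_toNNReal hE.ne]

theorem EnergyBounded.memLp_two {N : ℕ} {K : EuclideanSpace ℝ (Fin N) → ℝ}
    {Ω : Set (EuclideanSpace ℝ (Fin N))} (h : EnergyBounded N K Ω 2)
    {f : EuclideanSpace ℝ (Fin N) → ℝ} (hf : Measurable f) (hf0 : ∀ x ∉ Ω, f x = 0)
    (hE : kernelEnergy N K f < ⊤) : MemLp f 2 := by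
  simpa using h.memLp two_pos hf hf0 hE

theorem exists_le_kernelTail {N : ℕ} {K : EuclideanSpace ℝ (Fin N) → ℝ} {s : ℝ} (hs : 0 ≤ s)
    (hlim : Tendsto (fun r : ℝ => ENNReal.ofReal (r ^ (2 * s)) * kernelTail N K r)
      (𝓝[>] (0 : ℝ)) (𝓝 ⊤)) (M : ℝ) :
    ∃ r : ℝ, 0 < r ∧ ENNReal.ofReal M ≤ kernelTail N K r := by
  have h1 := hlim.eventually (lt_mem_nhds (show ENNReal.ofReal M < ⊤ by simp))
  have h2 : ∀ᶠ r : ℝ in 𝓝[>] 0, r ∈ Ioo (0 : ℝ) 1 := Ioo_mem_nhdsGT one_pos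
  obtain ⟨r, hr1, hr0, hr⟩ := (h1.and h2).exists
  refine ⟨r, hr0, hr1.le.trans ?_⟩
  refine mul_le_of_le_one_left' ?_
  rw [ENNReal.ofReal_le_one]
  exact Real.rpow_le_one hr0.le hr.le (by positivity)

/-- The space of finite energy functions embeds compactly in `L²`. -/
theorem exists_subseq_tendsto_eLpNorm_two {N : ℕ} (hN : 2 ≤ N)
    {K : EuclideanSpace ℝ (Fin N) → ℝ} (hmeas : Measurable K)
    (hpos : ∀ x : EuclideanSpace ℝ (Fin N), x ≠ 0 → 0 < K x) (hint : kernelIntegrable N K)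
    (hmono : ∀ x y : EuclideanSpace ℝ (Fin N), x ≠ 0 → y ≠ 0 → ‖x‖ ≤ ‖y‖ → K y ≤ K x)
    {Ω : Set (EuclideanSpace ℝ (Fin N))} (hΩo : IsOpen Ω) (hΩb : Bornology.IsBounded Ω)
    {s : ℝ} (hs : 0 ≤ s)
    (hlim : Tendsto (fun r : ℝ => ENNReal.ofReal (r ^ (2 * s)) * kernelTail N K r)
      (𝓝[>] (0 : ℝ)) (𝓝 ⊤))
    {f : ℕ → EuclideanSpace ℝ (Fin N) → ℝ} (hf : ∀ n, Measurable (f n))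
    (hf0 : ∀ n, ∀ x ∉ Ω, f n x = 0) {T : NNReal} (hT : ∀ n, kernelEnergy N K (f n) ≤ T) :
    ∃ (φ : ℕ → ℕ) (u : EuclideanSpace ℝ (Fin N) → ℝ), StrictMono φ ∧ Measurable u ∧
      (∀ x ∉ Ω, u x = 0) ∧ Tendsto (fun n => eLpNorm (f (φ n) - u) 2 volume) atTop (𝓝 0) ∧
      ∀ᵐ x, Tendsto (fun n => f (φ n) x) atTop (𝓝 (u x)) := by
  have hEB := energyBounded_two hN hmeas hpos hint hmono hΩo hΩb
  have hf2 : ∀ n, MemLp (f n) 2 := fun n =>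
    hEB.memLp_two (hf n) (hf0 n) ((hT n).trans_lt (by simp))
  obtain ⟨C, hC⟩ := hEB T
  have hbound : ∀ n, ‖(hf2 n).toLp‖ ≤ ((C : ℝ≥0∞) ^ (1 / 2 : ℝ)).toReal := by
    intro n
    rw [Lp.norm_toLp]
    refine ENNReal.toReal_mono (by simp) ?_
    rw [eLpNorm_eq_lintegral_rpow_enorm_toReal (by simp) (by simp)]
    simp only [ENNReal.toReal_ofNat]
    gcongr
    exact hC (f n) (hf n) (hf0 n) (hT n)
  set B := ((C : ℝ≥0∞) ^ (1 / 2 : ℝ)).toReal with hB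
  have : Fact ((2 : ℝ≥0∞) ≠ ⊤) := ⟨by simp⟩
  obtain ⟨φ, hφ, hweak⟩ := exists_subseq_tendsto_inner (fun n => (hf2 n).toLp) B hbound
  have hcauchy : CauchySeq (fun n => (hf2 (φ n)).toLp) := by
    rw [EMetric.cauchySeq_iff]
    intro ε hε
    obtain ⟨e, he0, heε⟩ := ENNReal.lt_iff_exists_nnreal_btwn.1 hε
    have he0 : 0 < e := by exact_mod_cast he0
    obtain ⟨r, hr, hrM⟩ := exists_le_kernelTail hs hlim ((8 * T + 1) / (e : ℝ) ^ 2)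
    set k := truncKernel N K r with hk
    set τ := (kernelTail N K r).toReal with hτ
    have hkm : Measurable k := measurable_truncKernel hmeas
    have hkL2 : ∀ x, MemLp (fun y => k (x - y)) 2 := fun x =>
      (memLp_truncKernel hN hmeas hpos hint hmono hr).comp_measurePreserving
        (Measure.measurePreserving_sub_left volume x)
    set c : ℕ → EuclideanSpace ℝ (Fin N) → ℝ := fun n x => ∫ y, k (x - y) * f (φ n) y with hc
    have hcm : ∀ n, Measurable (c n) := by
      intro n
      refine StronglyMeasurable.measurable ?_
      refine StronglyMeasurable.integral_prod_right (f := fun x y => k (x - y) * f (φ n) y) ?_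
      have := hf (φ n)
      exact Measurable.stronglyMeasurable (by fun_prop)
    have hcinner : ∀ n x, c n x = inner ℝ (hf2 (φ n)).toLp (hkL2 x).toLp := by
      intro n x
      rw [L2.inner_def]
      refine integral_congr_ae ?_
      filter_upwards [(hf2 (φ n)).coeFn_toLp, (hkL2 x).coeFn_toLp] with y h1 h2
      simp [h1, h2]
    have hcconv : ∀ x, ∃ l, Tendsto (fun n => c n x) atTop (𝓝 l) := by
      intro x
      obtain ⟨l, hl⟩ := hweak (hkL2 x).toLp
      exact ⟨l, by simpa only [hcinner] using hl⟩
    choose c' hc' using hcconv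
    have hc'm : Measurable c' := measurable_of_tendsto_metrizable hcm (tendsto_pi_nhds.2 hc')
    set G := (eLpNorm k 2 volume).toReal with hG
    have hcb : ∀ n x, |c n x| ≤ B * G := by
      intro n x
      rw [hcinner]
      refine (abs_real_inner_le_norm _ _).trans ?_
      refine mul_le_mul (hbound _) (le_of_eq ?_) (norm_nonneg _) ENNReal.toReal_nonneg
      rw [Lp.norm_toLp, hG]
      congr 1
      exact eLpNorm_comp_measurePreserving hkm.aestronglyMeasurable
        (Measure.measurePreserving_sub_left volume x)
    have hc'b : ∀ x, |c' x| ≤ B * G := fun x =>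
      le_of_tendsto (hc' x).abs (Eventually.of_forall fun n => hcb n x)
    set J : ℕ → ℝ≥0∞ := fun n => ∫⁻ x in Ω, ENNReal.ofReal ((c n x - c' x) ^ 2) with hJ
    have hJ0 : Tendsto J atTop (𝓝 0) := by
      have := tendsto_lintegral_of_dominated_convergence (μ := volume.restrict Ω)
        (F := fun n x => ENNReal.ofReal ((c n x - c' x) ^ 2)) (f := fun _ => 0)
        (fun _ => ENNReal.ofReal ((B * G + B * G) ^ 2))
        (fun n => by have := hcm n; fun_prop)
        (fun n => Eventually.of_forall fun x => ?_) ?_ (Eventually.of_forall fun x => ?_)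
      · simpa using this
      · refine ENNReal.ofReal_le_ofReal ?_
        rw [← sq_abs]
        exact pow_le_pow_left₀ (abs_nonneg _)
          ((abs_sub _ _).trans (add_le_add (hcb n x) (hc'b x))) 2
      · rw [setLIntegral_const]
        exact ENNReal.mul_ne_top ENNReal.ofReal_ne_top hΩb.measure_lt_top.ne
      · have := ((hc' x).sub_const (c' x)).pow 2
        simpa using ENNReal.tendsto_ofReal this
    have hJJ : ∀ᶠ n in atTop, ENNReal.ofReal (4 / τ) * (2 * J n) < 1 / 2 := by
      have : Tendsto (fun n => ENNReal.ofReal (4 / τ) * (2 * J n)) atTop (𝓝 0) := by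
        have := ENNReal.Tendsto.const_mul (a := ENNReal.ofReal (4 / τ))
          (ENNReal.Tendsto.const_mul (a := 2) hJ0 (Or.inr (by simp))) (Or.inr (by simp))
        simpa using this
      exact this.eventually (gt_mem_nhds (by simp))
    obtain ⟨n₀, hn₀⟩ := eventually_atTop.1 hJJ
    refine ⟨n₀, fun m hm n hn => ?_⟩
    refine lt_of_le_of_lt ?_ heε
    rw [Lp.edist_toLp_toLp]
    set d := f (φ m) - f (φ n) with hd
    have hdm : Measurable d := (hf _).sub (hf _)
    have hd0 : ∀ x ∉ Ω, d x = 0 := fun x hx => by simp [hd, hf0 _ x hx]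
    have hd2 : MemLp d 2 := (hf2 _).sub (hf2 _)
    have hdE : kernelEnergy N K d ≤ 4 * T := by
      refine (kernelEnergy_sub_le hmeas (hf _) (hf _)).trans ?_
      calc _ ≤ 2 * (T : ℝ≥0∞) + 2 * T := by gcongr <;> exact hT _
        _ = 4 * T := by ring
    have hcd : ∀ x, ∫ y, k (x - y) * d y = c m x - c n x := by
      intro x
      have hi : ∀ j, Integrable (fun y => k (x - y) * f (φ j) y) := fun j =>
        (hkL2 x).integrable_mul (hf2 (φ j))
      simp only [hc]
      rw [← integral_sub (hi m) (hi n)]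
      refine integral_congr_ae (Eventually.of_forall fun y => ?_)
      simp only [hd, Pi.sub_apply]
      ring
    have hcdJ : ∫⁻ x in Ω, ENNReal.ofReal ((∫ y, k (x - y) * d y) ^ 2) ≤ 2 * J m + 2 * J n := by
      have hcmm := hcm m
      have hcmn := hcm n
      simp only [hJ]
      rw [← lintegral_const_mul _ (by fun_prop), ← lintegral_const_mul _ (by fun_prop),
        ← lintegral_add_left (by fun_prop)]
      refine lintegral_mono fun x => ?_
      rw [hcd, ← ENNReal.ofReal_ofNat 2, ← ENNReal.ofReal_mul (by norm_num),
        ← ENNReal.ofReal_mul (by norm_num), ← ENNReal.ofReal_add (by positivity) (by positivity)]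
      refine ENNReal.ofReal_le_ofReal ?_
      nlinarith [sq_nonneg ((c m x - c' x) + (c n x - c' x))]
    have hmain : (∫⁻ x, ENNReal.ofReal (d x ^ 2)) *
        ENNReal.ofReal ((8 * T + 1) / (e : ℝ) ^ 2) ≤ ENNReal.ofReal (8 * T + 1) := by
      calc _ ≤ (∫⁻ x, ENNReal.ofReal (d x ^ 2)) * kernelTail N K r := by gcongr
        _ ≤ _ := lintegral_sq_mul_kernelTail_le hN hmeas hpos hint hmono hr hdm hd0 hd2
        _ ≤ 2 * (4 * T) + ENNReal.ofReal (4 / τ) * (2 * J m + 2 * J n) := by gcongr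
        _ ≤ 8 * T + (1 / 2 + 1 / 2) := by
          rw [mul_add, ← mul_assoc]
          gcongr
          · norm_num
          · exact (hn₀ m hm).le
          · exact (hn₀ n hn).le
        _ = ENNReal.ofReal (8 * T + 1) := by
          rw [ENNReal.add_halves, ENNReal.ofReal_add (by positivity) (by positivity),
            ENNReal.ofReal_mul (by norm_num)]
          simp
    have he2 : ∫⁻ x, ENNReal.ofReal (d x ^ 2) ≤ (e : ℝ≥0∞) ^ (2 : ℝ) := by
      have hq0 : 0 < (8 * (T : ℝ) + 1) / (e : ℝ) ^ 2 := by positivity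
      rw [← ENNReal.le_div_iff_mul_le (Or.inl (by simpa using hq0)) (Or.inl (by simp)),
        ← ENNReal.ofReal_div_of_pos hq0] at hmain
      refine hmain.trans (le_of_eq ?_)
      have : (8 * (T : ℝ) + 1) ≠ 0 := by positivity
      rw [div_div_cancel₀ this, ENNReal.ofReal_pow (by positivity)]
      simp
    rw [eLpNorm_eq_lintegral_rpow_enorm_toReal (by simp) (by simp)]
    simp only [ENNReal.toReal_ofNat, enorm_rpow_two]
    calc _ ≤ ((e : ℝ≥0∞) ^ (2 : ℝ)) ^ (1 / 2 : ℝ) := by gcongr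
      _ = e := by rw [← ENNReal.rpow_mul]; simp
  obtain ⟨F, hF⟩ := cauchySeq_tendsto_of_complete hcauchy
  obtain ⟨ψ, hψ, hae⟩ := (tendstoInMeasure_of_tendsto_Lp hF).exists_seq_tendsto_ae
  set u : EuclideanSpace ℝ (Fin N) → ℝ := Ω.indicator F with hu
  have hum : Measurable u := (Lp.stronglyMeasurable F).measurable.indicator hΩo.measurableSet
  have hae1 : ∀ᵐ x, Tendsto (fun n => f (φ (ψ n)) x) atTop (𝓝 (F x)) := by
    have : ∀ᵐ x, ∀ n, ((hf2 (φ n)).toLp : EuclideanSpace ℝ (Fin N) → ℝ) x = f (φ n) x :=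
      ae_all_iff.2 fun n => (hf2 (φ n)).coeFn_toLp
    filter_upwards [hae, this] with x h1 h2
    simpa only [h2] using h1
  have huF : u =ᵐ[volume] F := by
    filter_upwards [hae1] with x hx
    by_cases hxΩ : x ∈ Ω
    · rw [hu, indicator_of_mem hxΩ]
    · rw [hu, indicator_of_notMem hxΩ]
      refine tendsto_nhds_unique (tendsto_const_nhds (x := (0 : ℝ)) (f := (atTop : Filter ℕ))) ?_
      simpa only [hf0 _ x hxΩ] using hx
  refine ⟨φ ∘ ψ, u, hφ.comp hψ, hum, fun x hx => indicator_of_notMem hx _, ?_, ?_⟩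
  · have h1 := (Lp.tendsto_Lp_iff_tendsto_eLpNorm' _ _).1 (hF.comp hψ.tendsto_atTop)
    refine h1.congr fun n => eLpNorm_congr_ae ?_
    exact (hf2 (φ (ψ n))).coeFn_toLp.sub huF.symm
  · filter_upwards [hae1, huF] with x h1 h2
    rw [h2]
    exact h1

theorem mul_kernel_nonneg {N : ℕ} {K : EuclideanSpace ℝ (Fin N) → ℝ}
    (hpos : ∀ x : EuclideanSpace ℝ (Fin N), x ≠ 0 → 0 < K x)
    (f : EuclideanSpace ℝ (Fin N) → ℝ) (x y : EuclideanSpace ℝ (Fin N)) :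
    0 ≤ (f x - f y) ^ 2 * K (x - y) := by
  rcases eq_or_ne x y with rfl | h
  · simp
  · exact mul_nonneg (sq_nonneg _) (hpos _ (sub_ne_zero.2 h)).le

theorem integrable_sq_mul_kernel {N : ℕ} {K f : EuclideanSpace ℝ (Fin N) → ℝ}
    (hmeas : Measurable K) (hpos : ∀ x : EuclideanSpace ℝ (Fin N), x ≠ 0 → 0 < K x)
    (hf : Measurable f) (hE : kernelEnergy N K f < ⊤) :
    Integrable (fun q : EuclideanSpace ℝ (Fin N) × EuclideanSpace ℝ (Fin N) =>
      (f q.1 - f q.2) ^ 2 * K (q.1 - q.2)) := by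
  refine ⟨Measurable.aestronglyMeasurable (by fun_prop), ?_⟩
  rw [hasFiniteIntegral_iff_ofReal (Eventually.of_forall fun q => mul_kernel_nonneg hpos f _ _)]
  refine lt_of_eq_of_lt ?_ hE
  rw [kernelEnergy_eq_lintegral_prod hmeas hf]
  simp_rw [ENNReal.ofReal_mul (sq_nonneg _)]

theorem integrable_mul_mul_kernel {N : ℕ} {K f g : EuclideanSpace ℝ (Fin N) → ℝ}
    (hmeas : Measurable K) (hpos : ∀ x : EuclideanSpace ℝ (Fin N), x ≠ 0 → 0 < K x)
    (hf : Measurable f) (hg : Measurable g) (hEf : kernelEnergy N K f < ⊤)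
    (hEg : kernelEnergy N K g < ⊤) :
    Integrable (fun q : EuclideanSpace ℝ (Fin N) × EuclideanSpace ℝ (Fin N) =>
      (f q.1 - f q.2) * (g q.1 - g q.2) * K (q.1 - q.2)) := by
  refine ((integrable_sq_mul_kernel hmeas hpos hf hEf).add
    (integrable_sq_mul_kernel hmeas hpos hg hEg)).mono'
    (Measurable.aestronglyMeasurable (by fun_prop)) (Eventually.of_forall fun q => ?_)
  rcases eq_or_ne q.1 q.2 with h | h
  · simp [h]
  · have hK := hpos _ (sub_ne_zero.2 h)
    simp only [Pi.add_apply]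
    rw [Real.norm_eq_abs, abs_mul, abs_of_pos hK, ← add_mul]
    gcongr
    rw [abs_le]
    constructor <;> nlinarith [sq_nonneg ((f q.1 - f q.2) + (g q.1 - g q.2)),
      sq_nonneg ((f q.1 - f q.2) - (g q.1 - g q.2))]

theorem kernelEnergy_add_mul {N : ℕ} {K f g : EuclideanSpace ℝ (Fin N) → ℝ}
    (hmeas : Measurable K) (hpos : ∀ x : EuclideanSpace ℝ (Fin N), x ≠ 0 → 0 < K x)
    (hf : Measurable f) (hg : Measurable g) (hEf : kernelEnergy N K f < ⊤)
    (hEg : kernelEnergy N K g < ⊤) (t : ℝ) :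
    kernelEnergy N K (fun x => f x + t * g x) = ENNReal.ofReal
      ((∫ q : EuclideanSpace ℝ (Fin N) × EuclideanSpace ℝ (Fin N),
          (f q.1 - f q.2) ^ 2 * K (q.1 - q.2)) +
        2 * t * (∫ q : EuclideanSpace ℝ (Fin N) × EuclideanSpace ℝ (Fin N),
          (f q.1 - f q.2) * (g q.1 - g q.2) * K (q.1 - q.2)) +
        t ^ 2 * ∫ q : EuclideanSpace ℝ (Fin N) × EuclideanSpace ℝ (Fin N),
          (g q.1 - g q.2) ^ 2 * K (q.1 - q.2)) := by
  have hif := integrable_sq_mul_kernel hmeas hpos hf hEf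
  have hig := integrable_sq_mul_kernel hmeas hpos hg hEg
  have hifg := integrable_mul_mul_kernel hmeas hpos hf hg hEf hEg
  have hexp : ∀ q : EuclideanSpace ℝ (Fin N) × EuclideanSpace ℝ (Fin N),
      ((f q.1 + t * g q.1) - (f q.2 + t * g q.2)) ^ 2 * K (q.1 - q.2) =
      (f q.1 - f q.2) ^ 2 * K (q.1 - q.2) +
        2 * t * ((f q.1 - f q.2) * (g q.1 - g q.2) * K (q.1 - q.2)) +
        t ^ 2 * ((g q.1 - g q.2) ^ 2 * K (q.1 - q.2)) := fun q => by ring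
  have hi1 : Integrable (fun q : EuclideanSpace ℝ (Fin N) × EuclideanSpace ℝ (Fin N) =>
      (f q.1 - f q.2) ^ 2 * K (q.1 - q.2) +
        2 * t * ((f q.1 - f q.2) * (g q.1 - g q.2) * K (q.1 - q.2))) :=
    hif.add (hifg.const_mul (2 * t))
  have hi2 := hig.const_mul (t ^ 2)
  have hi3 : Integrable (fun q : EuclideanSpace ℝ (Fin N) × EuclideanSpace ℝ (Fin N) =>
      (f q.1 - f q.2) ^ 2 * K (q.1 - q.2) +
        2 * t * ((f q.1 - f q.2) * (g q.1 - g q.2) * K (q.1 - q.2)) +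
        t ^ 2 * ((g q.1 - g q.2) ^ 2 * K (q.1 - q.2))) := hi1.add hi2
  rw [← integral_const_mul, ← integral_const_mul, ← integral_add hif (hifg.const_mul (2 * t)),
    ← integral_add hi1 hi2, ofReal_integral_eq_lintegral_ofReal hi3
      (Eventually.of_forall fun q => by
        have := mul_kernel_nonneg hpos (fun x => f x + t * g x) q.1 q.2
        simp only [hexp q] at this
        exact this),
    kernelEnergy_eq_lintegral_prod hmeas (by fun_prop)]
  refine lintegral_congr fun q => ?_
  rw [← ENNReal.ofReal_mul (sq_nonneg _), hexp q]

/-- A bounded function supported in a ball and Lipschitz with constant one has finite energy. -/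
theorem kernelEnergy_cone_lt_top {N : ℕ} {K : EuclideanSpace ℝ (Fin N) → ℝ}
    (hmeas : Measurable K) (hint : kernelIntegrable N K)
    (x₀ : EuclideanSpace ℝ (Fin N)) {r : ℝ} (hr1 : r ≤ 1) :
    kernelEnergy N K (fun x => max 0 (r - dist x x₀)) < ⊤ := by
  set f : EuclideanSpace ℝ (Fin N) → ℝ := fun x => max 0 (r - dist x x₀) with hf
  set B := Metric.ball x₀ r with hB
  set k : EuclideanSpace ℝ (Fin N) → ℝ≥0∞ := fun x => ENNReal.ofReal (min (‖x‖ ^ 2) 1 * K x) with hk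
  have hkm : Measurable k := by fun_prop
  have hBm : MeasurableSet B := measurableSet_ball
  have hf0 : ∀ x ∉ B, f x = 0 := by
    intro x hx
    have : r ≤ dist x x₀ := by simpa [hB] using hx
    simp [hf, this]
  have hdiff : ∀ x y, (f x - f y) ^ 2 ≤ min (‖x - y‖ ^ 2) 1 := by
    intro x y
    have h1 : ∀ z, 0 ≤ f z ∧ f z ≤ 1 := fun z => ⟨le_max_left _ _, max_le zero_le_one (by
      have := dist_nonneg (x := z) (y := x₀); linarith)⟩
    have h2 : |f x - f y| ≤ ‖x - y‖ := by
      simp only [hf]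
      rw [max_comm 0, max_comm 0]
      refine (abs_max_sub_max_le_abs _ _ _).trans ?_
      rw [sub_sub_sub_cancel_left, abs_sub_comm, ← dist_eq_norm]
      exact abs_dist_sub_le _ _ _
    refine le_min ?_ ?_
    · rw [← sq_abs]; gcongr
    · have := h1 x; have := h1 y
      nlinarith
  have hpt : ∀ x y, ENNReal.ofReal ((f x - f y) ^ 2) * ENNReal.ofReal (K (x - y)) ≤
      B.indicator 1 x * k (x - y) + B.indicator 1 y * k (x - y) := by
    intro x y
    have hle : ENNReal.ofReal ((f x - f y) ^ 2) * ENNReal.ofReal (K (x - y)) ≤ k (x - y) := by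
      simp only [hk]
      rw [ENNReal.ofReal_mul (by positivity)]
      gcongr
      exact hdiff x y
    by_cases hx : x ∈ B
    · rw [indicator_of_mem hx, Pi.one_apply, one_mul]
      exact hle.trans le_self_add
    · by_cases hy : y ∈ B
      · rw [indicator_of_mem hy, Pi.one_apply, one_mul]
        exact hle.trans le_add_self
      · simp [hf0 x hx, hf0 y hy]
  have hind : Measurable (B.indicator (1 : EuclideanSpace ℝ (Fin N) → ℝ≥0∞)) :=
    measurable_one.indicator hBm
  have hM : ∫⁻ x, k x < ⊤ := hint
  have h1 : ∫⁻ x, ∫⁻ y, B.indicator 1 x * k (x - y) = volume B * ∫⁻ x, k x := by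
    have : ∀ x, ∫⁻ y, B.indicator 1 x * k (x - y) = B.indicator 1 x * ∫⁻ x, k x := by
      intro x
      rw [lintegral_const_mul _ (by fun_prop), lintegral_sub_left_eq_self k x]
    simp_rw [this]
    rw [lintegral_mul_const _ hind, lintegral_indicator_one hBm]
  have h2 : ∫⁻ x, ∫⁻ y, B.indicator 1 y * k (x - y) = volume B * ∫⁻ x, k x := by
    rw [lintegral_lintegral_swap (Measurable.aemeasurable (by fun_prop))]
    have : ∀ y, ∫⁻ x, B.indicator 1 y * k (x - y) = B.indicator 1 y * ∫⁻ x, k x := by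
      intro x
      rw [lintegral_const_mul _ (by fun_prop), lintegral_sub_right_eq_self k x]
    simp_rw [this]
    rw [lintegral_mul_const _ hind, lintegral_indicator_one hBm]
  rw [kernelEnergy_eq]
  refine lt_of_le_of_lt (lintegral_mono fun x => lintegral_mono fun y => hpt x y) ?_
  have h3 : ∀ x, ∫⁻ y, (B.indicator 1 x * k (x - y) + B.indicator 1 y * k (x - y)) =
      (∫⁻ y, B.indicator 1 x * k (x - y)) + ∫⁻ y, B.indicator 1 y * k (x - y) :=
    fun x => lintegral_add_left (by fun_prop) _
  simp_rw [h3]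
  rw [lintegral_add_left (Measurable.lintegral_prod_right (f := fun x y =>
    B.indicator (1 : EuclideanSpace ℝ (Fin N) → ℝ≥0∞) x * k (x - y)) (by fun_prop)), h1, h2]
  have := ENNReal.mul_lt_top (measure_ball_lt_top (μ := volume) (x := x₀) (r := r)) hM
  exact ENNReal.add_lt_top.2 ⟨this, this⟩

/-- Directional derivative of `f ↦ ∫ |f|^p`. -/
theorem hasDerivAt_integral_abs_rpow {α : Type*} [MeasurableSpace α] {μ : Measure α} {p : ℝ}
    (hp : 1 < p) {f g : α → ℝ} (hf : MemLp f (ENNReal.ofReal p) μ)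
    (hg : MemLp g (ENNReal.ofReal p) μ) :
    HasDerivAt (fun t : ℝ => ∫ x, |f x + t * g x| ^ p ∂μ)
      (p * ∫ x, |f x| ^ (p - 2) * f x * g x ∂μ) 0 := by
  have hp0 : 0 < p := by linarith
  have hpow : ∀ {h : α → ℝ}, MemLp h (ENNReal.ofReal p) μ → Integrable (fun x => |h x| ^ p) μ := by
    intro h hh
    have := hh.integrable_norm_rpow (by simpa using hp0) (by simp)
    simpa [ENNReal.toReal_ofReal hp0.le] using this
  have hsum : MemLp (fun x => |f x| + |g x|) (ENNReal.ofReal p) μ := hf.abs.add hg.abs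
  have hder := hasDerivAt_integral_of_dominated_loc_of_deriv_le (μ := μ) (𝕜 := ℝ)
    (F := fun t x => |f x + t * g x| ^ p)
    (F' := fun t x => p * |f x + t * g x| ^ (p - 2) * (f x + t * g x) * g x)
    (x₀ := 0) (s := Metric.ball 0 1) (bound := fun x => p * (|f x| + |g x|) ^ p)
    (Metric.ball_mem_nhds 0 one_pos) ?_ ?_ ?_ ?_ ?_ ?_
  · refine hder.2.congr_deriv ?_
    rw [← integral_const_mul]
    refine integral_congr_ae (Eventually.of_forall fun x => ?_)
    simp only [zero_mul, add_zero]
    ring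
  · refine Eventually.of_forall fun t => ?_
    exact (hpow (hf.add (hg.const_mul t))).aestronglyMeasurable
  · simpa using hpow hf
  · have hfm := hf.aestronglyMeasurable.aemeasurable
    have hgm := hg.aestronglyMeasurable.aemeasurable
    exact AEMeasurable.aestronglyMeasurable (by fun_prop)
  · refine Eventually.of_forall fun x t ht => ?_
    have ht1 : |t| ≤ 1 := by
      have : |t| < 1 := by simpa using ht
      exact this.le
    set a := |f x| + |g x| with ha
    have ha0 : 0 ≤ a := by positivity
    have h1 : |f x + t * g x| ≤ a := by
      refine (abs_add_le _ _).trans ?_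
      rw [abs_mul]
      have := mul_le_mul_of_nonneg_right ht1 (abs_nonneg (g x))
      rw [ha]; linarith
    have h2 : |f x + t * g x| ^ (p - 2) * |f x + t * g x| = |f x + t * g x| ^ (p - 1) := by
      rcases (abs_nonneg (f x + t * g x)).eq_or_lt with h | h
      · rw [← h, mul_zero, Real.zero_rpow (by linarith)]
      · nth_rewrite 2 [← Real.rpow_one |f x + t * g x|]
        rw [← Real.rpow_add h]; congr 1; ring
    have h3 : a ^ (p - 1) * a = a ^ p := by
      rcases ha0.eq_or_lt with h | h
      · rw [← h, mul_zero, Real.zero_rpow hp0.ne']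
      · nth_rewrite 2 [← Real.rpow_one a]
        rw [← Real.rpow_add h]; congr 1; ring
    rw [Real.norm_eq_abs, abs_mul, abs_mul, abs_mul, abs_of_pos hp0,
      abs_of_nonneg (Real.rpow_nonneg (abs_nonneg _) _), mul_assoc p, h2, mul_assoc, ← h3]
    have h4 : |g x| ≤ a := by rw [ha]; have := abs_nonneg (f x); linarith
    have h5 : (0 : ℝ) ≤ p - 1 := by linarith
    gcongr
  · have := hpow hsum
    refine (this.const_mul p).congr (Eventually.of_forall fun x => ?_)
    have : 0 ≤ |f x| + |g x| := by positivity
    simp only [abs_of_nonneg this]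
  · refine Eventually.of_forall fun x t _ => ?_
    have h1 := hasDerivAt_abs_rpow (f x + t * g x) hp
    have h2 : HasDerivAt (fun t : ℝ => f x + t * g x) (g x) t := by
      simpa using ((hasDerivAt_id t).mul_const (g x)).const_add (f x)
    exact h1.comp t h2

theorem lintegral_enorm_rpow_eq {α : Type*} [MeasurableSpace α] {μ : Measure α} {p : ℝ}
    (hp : 0 < p) (f : α → ℝ) :
    ∫⁻ x, ‖f x‖ₑ ^ p ∂μ = eLpNorm f (ENNReal.ofReal p) μ ^ p := by
  rw [lintegral_rpow_enorm_eq_rpow_eLpNorm' hp, eLpNorm_eq_eLpNorm' (by simpa) (by simp),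
    ENNReal.toReal_ofReal hp.le]

theorem integral_abs_rpow_eq_toReal {α : Type*} [MeasurableSpace α] {μ : Measure α} {p : ℝ}
    (hp : 0 ≤ p) {f : α → ℝ} (hf : Measurable f) :
    ∫ x, |f x| ^ p ∂μ = (∫⁻ x, ‖f x‖ₑ ^ p ∂μ).toReal := by
  rw [integral_eq_lintegral_of_nonneg_ae (Eventually.of_forall fun x => by positivity)
    (Measurable.aestronglyMeasurable (by fun_prop))]
  congr 1
  refine lintegral_congr fun x => ?_
  rw [← ENNReal.ofReal_rpow_of_nonneg (abs_nonneg _) hp, Real.enorm_eq_ofReal_abs]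

/-- A sequence bounded in `L^q` and tending to zero in `L²` tends to zero in `L^p`
for `2 ≤ p < q`. -/
theorem tendsto_eLpNorm_of_interpolation {α : Type*} [MeasurableSpace α] {μ : Measure α}
    {p q : ℝ} (hp2 : 2 ≤ p) (hpq : p < q) {d : ℕ → α → ℝ} (hd : ∀ n, Measurable (d n))
    {C : NNReal} (hC : ∀ n, ∫⁻ x, ‖d n x‖ₑ ^ q ∂μ ≤ C)
    (h : Tendsto (fun n => eLpNorm (d n) 2 μ) atTop (𝓝 0)) :
    Tendsto (fun n => eLpNorm (d n) (ENNReal.ofReal p) μ) atTop (𝓝 0) := by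
  have hp0 : 0 < p := by linarith
  have hq2 : 0 < q - 2 := by linarith
  set a := (q - p) / (q - 2) with ha
  set b := (p - 2) / (q - 2) with hb
  have ha0 : 0 < a := div_pos (by linarith) hq2
  have hb0 : 0 ≤ b := div_nonneg (by linarith) hq2.le
  have hab : a + b = 1 := by rw [ha, hb]; field_simp; ring
  have hp : 2 * a + q * b = p := by rw [ha, hb]; field_simp; ring
  have hle : ∀ n, ∫⁻ x, ‖d n x‖ₑ ^ p ∂μ ≤ (eLpNorm (d n) 2 μ ^ (2 : ℝ)) ^ a * (C : ℝ≥0∞) ^ b := by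
    intro n
    have h2 := lintegral_enorm_rpow_eq (μ := μ) two_pos (d n)
    rw [ENNReal.ofReal_ofNat] at h2
    calc ∫⁻ x, ‖d n x‖ₑ ^ p ∂μ
        = ∫⁻ x, (‖d n x‖ₑ ^ (2 : ℝ)) ^ a * (‖d n x‖ₑ ^ q) ^ b ∂μ := by
          refine lintegral_congr fun x => ?_
          rw [← ENNReal.rpow_mul, ← ENNReal.rpow_mul, ← ENNReal.rpow_add_of_nonneg _ _
            (by positivity) (mul_nonneg (by linarith) hb0), hp]
      _ ≤ (∫⁻ x, ‖d n x‖ₑ ^ (2 : ℝ) ∂μ) ^ a * (∫⁻ x, ‖d n x‖ₑ ^ q ∂μ) ^ b :=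
          ENNReal.lintegral_mul_norm_pow_le (Measurable.aemeasurable (by fun_prop))
            (Measurable.aemeasurable (by fun_prop)) ha0.le hb0 hab
      _ ≤ _ := by
          rw [h2]
          gcongr
          exact hC n
  have h1 : Tendsto (fun n => (eLpNorm (d n) 2 μ ^ (2 : ℝ)) ^ a * (C : ℝ≥0∞) ^ b) atTop (𝓝 0) := by
    have h3 := (h.ennrpow_const 2).ennrpow_const a
    rw [ENNReal.zero_rpow_of_pos two_pos, ENNReal.zero_rpow_of_pos ha0] at h3
    simpa using ENNReal.Tendsto.mul_const h3
      (Or.inr (ENNReal.rpow_ne_top_of_nonneg hb0 ENNReal.coe_ne_top))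
  have h2 := (tendsto_of_tendsto_of_tendsto_of_le_of_le tendsto_const_nhds h1
    (fun _ => zero_le) hle).ennrpow_const (1 / p)
  rw [ENNReal.zero_rpow_of_pos (by positivity)] at h2
  refine h2.congr fun n => ?_
  rw [lintegral_enorm_rpow_eq hp0, ← ENNReal.rpow_mul, mul_one_div_cancel hp0.ne', ENNReal.rpow_one]

theorem integral_abs_const_mul_rpow {α : Type*} [MeasurableSpace α] {μ : Measure α} (p a : ℝ)
    (f : α → ℝ) : ∫ x, |a * f x| ^ p ∂μ = |a| ^ p * ∫ x, |f x| ^ p ∂μ := by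
  rw [← integral_const_mul]
  refine integral_congr_ae (Eventually.of_forall fun x => ?_)
  simp only [abs_mul, Real.mul_rpow (abs_nonneg _) (abs_nonneg _)]

/-- Nonempty open sets support functions of energy at most one that are not a.e. zero. -/
theorem exists_kernelEnergy_le_one {N : ℕ} {K : EuclideanSpace ℝ (Fin N) → ℝ}
    (hmeas : Measurable K) (hint : kernelIntegrable N K)
    {Ω : Set (EuclideanSpace ℝ (Fin N))} (hΩo : IsOpen Ω) (hΩne : Ω.Nonempty) :
    ∃ f : EuclideanSpace ℝ (Fin N) → ℝ, Measurable f ∧ (∀ x ∉ Ω, f x = 0) ∧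
      kernelEnergy N K f ≤ 1 ∧ ¬ (f =ᵐ[volume] 0) := by
  obtain ⟨x₀, hx₀⟩ := hΩne
  obtain ⟨ε, hε, hball⟩ := Metric.isOpen_iff.1 hΩo x₀ hx₀
  set r := min ε 1 with hr
  have hr0 : 0 < r := lt_min hε one_pos
  set g : EuclideanSpace ℝ (Fin N) → ℝ := fun x => max 0 (r - dist x x₀) with hg
  have hgm : Measurable g := by fun_prop
  have hE := kernelEnergy_cone_lt_top hmeas hint x₀ (min_le_right ε 1)
  set e := (kernelEnergy N K g).toReal with he
  have he0 : 0 ≤ e := ENNReal.toReal_nonneg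
  have hEe : kernelEnergy N K g = ENNReal.ofReal e := (ENNReal.ofReal_toReal hE.ne).symm
  have ha : 0 < (√(e + 1))⁻¹ := by positivity
  refine ⟨fun x => (√(e + 1))⁻¹ * g x, by fun_prop, fun x hx => ?_, ?_, fun h => ?_⟩
  · have h1 : x ∉ Metric.ball x₀ ε := fun h => hx (hball h)
    have h2 : r ≤ dist x x₀ := (min_le_left _ _).trans (by simpa using h1)
    simp [hg, h2]
  · rw [kernelEnergy_const_mul hmeas hgm, hEe, ← ENNReal.ofReal_mul (sq_nonneg _), inv_pow,
      Real.sq_sqrt (by positivity), ENNReal.ofReal_le_one, inv_mul_le_one₀ (by positivity)]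
    linarith
  · have h1 : Metric.ball x₀ r ⊆
        {x | ¬ ((√(e + 1))⁻¹ * g x = (0 : EuclideanSpace ℝ (Fin N) → ℝ) x)} := by
      intro x hx
      have h2 : 0 < g x := lt_max_of_lt_right (sub_pos.2 (Metric.mem_ball.1 hx))
      exact (mul_pos ha h2).ne'
    exact (Metric.measure_ball_pos volume x₀ hr0).ne' (measure_mono_null h1 (ae_iff.1 h))

/-- The functional `∫ |f|^p` attains its maximum, which is positive, on the unit energy ball. -/
theorem exists_isMax_integral_abs_rpow {N : ℕ} (hN : 2 ≤ N) {K : EuclideanSpace ℝ (Fin N) → ℝ}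
    (hmeas : Measurable K) (hpos : ∀ x : EuclideanSpace ℝ (Fin N), x ≠ 0 → 0 < K x)
    (hint : kernelIntegrable N K)
    (hmono : ∀ x y : EuclideanSpace ℝ (Fin N), x ≠ 0 → y ≠ 0 → ‖x‖ ≤ ‖y‖ → K y ≤ K x)
    {Ω : Set (EuclideanSpace ℝ (Fin N))} (hΩo : IsOpen Ω) (hΩb : Bornology.IsBounded Ω)
    (hΩne : Ω.Nonempty) {s : ℝ} (hs : 0 ≤ s)
    (hlim : Tendsto (fun r : ℝ => ENNReal.ofReal (r ^ (2 * s)) * kernelTail N K r)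
      (𝓝[>] (0 : ℝ)) (𝓝 ⊤))
    {p q : ℝ} (hp2 : 2 ≤ p) (hpq : p < q) (hq : EnergyBounded N K Ω q) :
    ∃ u : EuclideanSpace ℝ (Fin N) → ℝ, Measurable u ∧ (∀ x ∉ Ω, u x = 0) ∧
      kernelEnergy N K u ≤ 1 ∧ 0 < ∫ x, |u x| ^ p ∧
      ∀ f : EuclideanSpace ℝ (Fin N) → ℝ, Measurable f → (∀ x ∉ Ω, f x = 0) →
        kernelEnergy N K f ≤ 1 → ∫ x, |f x| ^ p ≤ ∫ x, |u x| ^ p := by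
  have hp0 : 0 < p := by linarith
  have hpE := (energyBounded_two hN hmeas hpos hint hmono hΩo hΩb).mono hq hp2 hpq.le
  set A : Set (EuclideanSpace ℝ (Fin N) → ℝ) :=
    {f | Measurable f ∧ (∀ x ∉ Ω, f x = 0) ∧ kernelEnergy N K f ≤ 1} with hA
  set S : Set ℝ≥0∞ := (fun f => eLpNorm f (ENNReal.ofReal p) volume) '' A with hS
  obtain ⟨f₀, hf₀, hf₀0, hf₀E, hf₀ne⟩ := exists_kernelEnergy_le_one hmeas hint hΩo hΩne
  obtain ⟨v, -, hvlim, hvS⟩ := exists_seq_tendsto_sSup (S := S) ⟨_, f₀, ⟨hf₀, hf₀0, hf₀E⟩, rfl⟩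
    (OrderTop.bddAbove S)
  choose f hfA hfv using hvS
  obtain ⟨φ, u, hφ, hu, hu0, h2, hae⟩ := exists_subseq_tendsto_eLpNorm_two hN hmeas hpos hint
    hmono hΩo hΩb hs hlim (f := f) (fun n => (hfA n).1) (fun n => (hfA n).2.1) (T := 1)
    (fun n => by simpa using (hfA n).2.2)
  have hE : kernelEnergy N K u ≤ 1 := kernelEnergy_le_of_tendsto_ae hmeas
    (fun n => (hfA (φ n)).1) hu hae (fun n => (hfA (φ n)).2.2)
  obtain ⟨C, hC⟩ := hq 4
  have hp1 : Tendsto (fun n => eLpNorm (f (φ n) - u) (ENNReal.ofReal p) volume) atTop (𝓝 0) := by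
    refine tendsto_eLpNorm_of_interpolation hp2 hpq (fun n => (hfA (φ n)).1.sub hu)
      (fun n => hC _ ((hfA (φ n)).1.sub hu) (fun x hx => ?_) ?_) h2
    · simp [(hfA (φ n)).2.1 x hx, hu0 x hx]
    · refine (kernelEnergy_sub_le hmeas (hfA (φ n)).1 hu).trans ?_
      have h3 : 2 * kernelEnergy N K (f (φ n)) + 2 * kernelEnergy N K u ≤ 2 * 1 + 2 * 1 := by
        gcongr
        exact (hfA (φ n)).2.2
      exact h3.trans (by norm_num)
  have hmax : ∀ g ∈ A, eLpNorm g (ENNReal.ofReal p) volume ≤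
      eLpNorm u (ENNReal.ofReal p) volume := by
    intro g hg
    have hgS : eLpNorm g (ENNReal.ofReal p) volume ∈ S := mem_image_of_mem _ hg
    refine (le_sSup hgS).trans ?_
    refine le_of_tendsto_of_tendsto' (hvlim.comp hφ.tendsto_atTop)
      (by simpa using hp1.add_const (eLpNorm u (ENNReal.ofReal p) volume)) fun n => ?_
    have h3 := eLpNorm_add_le (μ := volume) (p := ENNReal.ofReal p)
      ((hfA (φ n)).1.sub hu).aestronglyMeasurable hu.aestronglyMeasurable
      (by rw [ENNReal.one_le_ofReal]; linarith)
    rw [sub_add_cancel] at h3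
    exact (hfv (φ n)).symm.trans_le h3
  have hfin : ∫⁻ x, ‖u x‖ₑ ^ p < ⊤ := by
    rw [lintegral_enorm_rpow_eq hp0]
    exact ENNReal.rpow_lt_top_of_nonneg hp0.le
      (hpE.memLp hp0 hu hu0 (hE.trans_lt ENNReal.one_lt_top)).2.ne
  refine ⟨u, hu, hu0, hE, ?_, fun g hg hg0 hgE => ?_⟩
  · rw [integral_abs_rpow_eq_toReal hp0.le hu]
    refine ENNReal.toReal_pos ?_ hfin.ne
    rw [lintegral_enorm_rpow_eq hp0]
    intro h
    have h3 := hmax f₀ ⟨hf₀, hf₀0, hf₀E⟩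
    rw [(ENNReal.rpow_eq_zero_iff_of_pos hp0).1 h, nonpos_iff_eq_zero,
      eLpNorm_eq_zero_iff hf₀.aestronglyMeasurable (by simpa using hp0)] at h3
    exact hf₀ne h3
  · rw [integral_abs_rpow_eq_toReal hp0.le hu, integral_abs_rpow_eq_toReal hp0.le hg]
    refine ENNReal.toReal_mono hfin.ne ?_
    rw [lintegral_enorm_rpow_eq hp0, lintegral_enorm_rpow_eq hp0]
    gcongr
    exact hmax g ⟨hg, hg0, hgE⟩

/-- Lagrange multiplier rule for maximizers of `∫ |f|^p` under the constraint of energy at most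
one. -/
theorem integral_mul_mul_kernel_of_isMax {N : ℕ} {K : EuclideanSpace ℝ (Fin N) → ℝ}
    (hmeas : Measurable K) (hpos : ∀ x : EuclideanSpace ℝ (Fin N), x ≠ 0 → 0 < K x)
    {Ω : Set (EuclideanSpace ℝ (Fin N))} {p : ℝ} (hp : 1 < p) (hpE : EnergyBounded N K Ω p)
    {u : EuclideanSpace ℝ (Fin N) → ℝ} (hu : Measurable u) (hu0 : ∀ x ∉ Ω, u x = 0)
    (hE : kernelEnergy N K u ≤ 1) (hS : 0 < ∫ x, |u x| ^ p)
    (hmax : ∀ f : EuclideanSpace ℝ (Fin N) → ℝ, Measurable f → (∀ x ∉ Ω, f x = 0) →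
      kernelEnergy N K f ≤ 1 → ∫ x, |f x| ^ p ≤ ∫ x, |u x| ^ p)
    {φ : EuclideanSpace ℝ (Fin N) → ℝ} (hφ : Measurable φ) (hφ0 : ∀ x ∉ Ω, φ x = 0)
    (hφE : kernelEnergy N K φ < ⊤) :
    (∫ x, |u x| ^ p) * (∫ q : EuclideanSpace ℝ (Fin N) × EuclideanSpace ℝ (Fin N),
      (u q.1 - u q.2) * (φ q.1 - φ q.2) * K (q.1 - q.2)) = ∫ x, |u x| ^ (p - 2) * u x * φ x := by
  have hp0 : 0 < p := by linarith
  have hE' : kernelEnergy N K u < ⊤ := hE.trans_lt ENNReal.one_lt_top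
  have hEe : ∀ t : ℝ, _ := fun t => kernelEnergy_add_mul hmeas hpos hu hφ hE' hφE t
  set S := ∫ x, |u x| ^ p
  set Q := ∫ q : EuclideanSpace ℝ (Fin N) × EuclideanSpace ℝ (Fin N),
    (u q.1 - u q.2) ^ 2 * K (q.1 - q.2)
  set B := ∫ q : EuclideanSpace ℝ (Fin N) × EuclideanSpace ℝ (Fin N),
    (u q.1 - u q.2) * (φ q.1 - φ q.2) * K (q.1 - q.2)
  set D := ∫ q : EuclideanSpace ℝ (Fin N) × EuclideanSpace ℝ (Fin N),
    (φ q.1 - φ q.2) ^ 2 * K (q.1 - q.2)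
  have hEQ : kernelEnergy N K u = ENNReal.ofReal Q := by simpa using hEe 0
  have hscale : ∀ f : EuclideanSpace ℝ (Fin N) → ℝ, Measurable f → (∀ x ∉ Ω, f x = 0) →
      ∀ e : ℝ, 0 < e → kernelEnergy N K f = ENNReal.ofReal e →
      ∫ x, |f x| ^ p ≤ S * e ^ (p / 2) := by
    intro f hf hf0 e he hfe
    have h1 := hmax (fun x => (√e)⁻¹ * f x) (by fun_prop) (fun x hx => by simp [hf0 x hx]) (by
      rw [kernelEnergy_const_mul hmeas hf, hfe, ← ENNReal.ofReal_mul (sq_nonneg _), inv_pow,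
        Real.sq_sqrt he.le, inv_mul_cancel₀ he.ne', ENNReal.ofReal_one])
    rw [integral_abs_const_mul_rpow, abs_of_pos (by positivity), Real.inv_rpow (by positivity),
      Real.sqrt_eq_rpow, ← Real.rpow_mul he.le, inv_mul_le_iff₀ (by positivity)] at h1
    rwa [mul_comm, show p / 2 = 1 / 2 * p by ring]
  have hQ0 : 0 < Q := by
    by_contra! hQ
    have h1 := hmax (fun x => 2 * u x) (by fun_prop) (fun x hx => by simp [hu0 x hx]) (by
      rw [kernelEnergy_const_mul hmeas hu, hEQ, ENNReal.ofReal_of_nonpos hQ]; simp)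
    rw [integral_abs_const_mul_rpow, abs_of_pos two_pos] at h1
    have h2 : (1 : ℝ) < 2 ^ p := Real.one_lt_rpow one_lt_two hp0
    exact absurd h1 (not_le.2 (lt_mul_of_one_lt_left hS h2))
  have hQ1 : Q = 1 := by
    refine le_antisymm (ENNReal.ofReal_le_one.1 (hEQ ▸ hE)) ?_
    by_contra! hQ
    have h1 := hscale u hu hu0 Q hQ0 hEQ
    have h2 : Q ^ (p / 2) < 1 := Real.rpow_lt_one hQ0.le hQ (by positivity)
    exact absurd h1 (not_le.2 (mul_lt_of_lt_one_right hS h2))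
  set e : ℝ → ℝ := fun t => Q + 2 * t * B + t ^ 2 * D with he
  have he0 : e 0 = 1 := by simp [he, hQ1]
  have hde : HasDerivAt e (2 * B) 0 := by
    have h1 : HasDerivAt e _ 0 :=
      (((((hasDerivAt_id (0 : ℝ)).const_mul 2).mul_const B).const_add Q).add
      ((hasDerivAt_pow 2 (0 : ℝ)).mul_const D))
    exact h1.congr_deriv (by simp)
  have hepos : ∀ᶠ t in 𝓝 0, 0 < e t :=
    hde.continuousAt.eventually_const_lt (by rw [he0]; exact one_pos)
  have hdJ := hasDerivAt_integral_abs_rpow hp (hpE.memLp hp0 hu hu0 hE')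
    (hpE.memLp hp0 hφ hφ0 hφE)
  have hdg := ((hde.rpow_const (p := p / 2) (Or.inl (by rw [he0]; exact one_ne_zero))).const_mul
    S).sub hdJ
  have hmin : IsLocalMin (fun t => S * e t ^ (p / 2) - ∫ x, |u x + t * φ x| ^ p) 0 := by
    filter_upwards [hepos] with t ht
    have h1 := hscale (fun x => u x + t * φ x) (by fun_prop)
      (fun x hx => by simp [hu0 x hx, hφ0 x hx]) (e t) ht (hEe t)
    have h2 : S * e 0 ^ (p / 2) - ∫ x, |u x + 0 * φ x| ^ p = 0 := by
      simp [he0, S]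
    rw [h2]
    exact sub_nonneg.2 h1
  have hz := hmin.hasDerivAt_eq_zero hdg
  rw [he0, Real.one_rpow] at hz
  have : p * (S * B - ∫ x, |u x| ^ (p - 2) * u x * φ x) = 0 := by linear_combination hz
  linarith [(mul_eq_zero.1 this).resolve_left hp0.ne']

/-- Below the critical exponent attached to `kernelS0` the tail condition holds with a
sufficiently large exponent. -/
theorem exists_subcritical_exponent {N : ℕ} (hN : 2 ≤ N) {K : EuclideanSpace ℝ (Fin N) → ℝ}
    (hs0 : 0 < kernelS0 N K ∧ kernelS0 N K ≤ 1) {p : ℝ} (hp2 : 2 < p)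
    (hpc : p < 2 * N / (N - 2 * kernelS0 N K)) :
    ∃ s : ℝ, 0 ≤ s ∧ 2 * s ≤ N ∧ (1 - 2 * s / N) * p < 2 ∧
      Tendsto (fun r : ℝ => ENNReal.ofReal (r ^ (2 * s)) * kernelTail N K r)
        (𝓝[>] (0 : ℝ)) (𝓝 ⊤) := by
  obtain ⟨h0, h1⟩ := hs0
  have hN' : (2 : ℝ) ≤ N := by exact_mod_cast hN
  have hN0 : (0 : ℝ) < N := by linarith
  have hden : 0 < N - 2 * kernelS0 N K := by
    by_contra! h
    have := div_nonpos_of_nonneg_of_nonpos (by positivity : (0 : ℝ) ≤ 2 * N) h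
    linarith
  rw [lt_div_iff₀ hden] at hpc
  set A : Set ℝ := {s : ℝ | 0 ≤ s ∧
    Tendsto (fun r : ℝ => ENNReal.ofReal (r ^ (2 * s)) * kernelTail N K r) (𝓝[>] (0 : ℝ)) (𝓝 ⊤)}
  have hSA : kernelS0 N K = sSup A := rfl
  have hne : A.Nonempty := by
    by_contra h
    rw [not_nonempty_iff_eq_empty] at h
    rw [hSA, h, Real.sSup_empty] at h0
    exact lt_irrefl _ h0
  have hbdd : BddAbove A := by
    by_contra h
    rw [hSA, Real.sSup_of_not_bddAbove h] at h0
    exact lt_irrefl _ h0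
  have hlt : N * (1 / 2 - 1 / p) < sSup A := by
    rw [← hSA]
    have : N * (1 / 2 - 1 / p) = (N * p - 2 * N) / (2 * p) := by field_simp
    rw [this, div_lt_iff₀ (by linarith)]
    linarith
  obtain ⟨s, hsA, hs⟩ := exists_lt_of_lt_csSup hne hlt
  have hss : s ≤ kernelS0 N K := le_csSup hbdd hsA
  refine ⟨s, hsA.1, by linarith, ?_, hsA.2⟩
  have h2 : N * (1 / 2 - 1 / p) = (N * p - 2 * N) / (2 * p) := by field_simp
  rw [h2, div_lt_iff₀ (by linarith)] at hs
  have h3 : (1 - 2 * s / N) * p = (N * p - s * (2 * p)) / N := by field_simp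
  rw [h3, div_lt_iff₀ hN0]
  linarith

theorem stmt19 (N : ℕ) (hN : 2 ≤ N) (K : EuclideanSpace ℝ (Fin N) → ℝ)
    (hmeas : Measurable K)
    (hpos : ∀ x : EuclideanSpace ℝ (Fin N), x ≠ 0 → 0 < K x)
    (hint : kernelIntegrable N K)
    (hsym : ∀ x : EuclideanSpace ℝ (Fin N), K (-x) = K x)
    (hmono : ∀ x y : EuclideanSpace ℝ (Fin N), x ≠ 0 → y ≠ 0 → ‖x‖ ≤ ‖y‖ → K y ≤ K x)
    (hs0 : 0 < kernelS0 N K ∧ kernelS0 N K ≤ 1)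
    (Ω : Set (EuclideanSpace ℝ (Fin N))) (hΩo : IsOpen Ω) (hΩb : Bornology.IsBounded Ω)
    (hΩne : Ω.Nonempty)
    (p : ℝ) (hp2 : 2 < p) (hpc : p < 2 * N / (N - 2 * kernelS0 N K)) :
    ∃ u : EuclideanSpace ℝ (Fin N) → ℝ, Measurable u ∧ (∀ x ∉ Ω, u x = 0) ∧
      kernelEnergy N K u < ⊤ ∧
      ¬ (u =ᵐ[volume] (0 : EuclideanSpace ℝ (Fin N) → ℝ)) ∧
      ∀ φ : EuclideanSpace ℝ (Fin N) → ℝ, Measurable φ → (∀ x ∉ Ω, φ x = 0) →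
        kernelEnergy N K φ < ⊤ →
        (∫ q : EuclideanSpace ℝ (Fin N) × EuclideanSpace ℝ (Fin N),
          (u q.1 - u q.2) * (φ q.1 - φ q.2) * K (q.1 - q.2)) =
          ∫ x in Ω, |u x| ^ (p - 2) * u x * φ x := by
  obtain ⟨s, hs, hsN, hsp, hlim⟩ := exists_subcritical_exponent hN hs0 hp2 hpc
  have hN0 : (0 : ℝ) < N := by exact_mod_cast (by omega : 0 < N)
  have hp0 : 0 < p := by linarith
  have hβ1 : 1 - 2 * s / N ≤ 1 := by
    have : 0 ≤ 2 * s / N := by positivity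
    linarith
  set q := p + (2 - (1 - 2 * s / N) * p) / 2 with hq
  have hpq : p < q := by linarith
  have hβ0 : 0 ≤ 1 - 2 * s / N := by
    rw [sub_nonneg, div_le_one hN0]
    exact hsN
  have hqs : (1 - 2 * s / N) * q < 2 := by
    rw [hq]
    nlinarith
  have hqE := energyBounded_of_subcritical hN hmeas hpos hint hmono hΩo hΩb hs hlim hsN
    (hp2.trans hpq).le hqs
  have hpE := (energyBounded_two hN hmeas hpos hint hmono hΩo hΩb).mono hqE hp2.le hpq.le
  obtain ⟨u, hu, hu0, hE, hS, hmax⟩ := exists_isMax_integral_abs_rpow hN hmeas hpos hint hmono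
    hΩo hΩb hΩne hs hlim hp2.le hpq hqE
  set S := ∫ x, |u x| ^ p with hSdef
  set c := S⁻¹ ^ (p - 2)⁻¹ with hc
  have hc0 : 0 < c := by positivity
  have hcp : |c| ^ (p - 2) = S⁻¹ := by
    rw [abs_of_pos hc0, hc, Real.rpow_inv_rpow (by positivity) (by linarith)]
  refine ⟨fun x => c * u x, by fun_prop, fun x hx => by simp [hu0 x hx], ?_, fun h => ?_,
    fun φ hφ hφ0 hφE => ?_⟩
  · rw [kernelEnergy_const_mul hmeas hu]
    exact ENNReal.mul_lt_top ENNReal.ofReal_lt_top (hE.trans_lt ENNReal.one_lt_top)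
  · refine hS.ne' ?_
    rw [hSdef, ← integral_zero (EuclideanSpace ℝ (Fin N)) ℝ]
    refine integral_congr_ae ?_
    filter_upwards [h] with x hx
    have : u x = 0 := (mul_eq_zero.1 hx).resolve_left hc0.ne'
    simp [this, Real.zero_rpow hp0.ne']
  · have hL := integral_mul_mul_kernel_of_isMax hmeas hpos (by linarith) hpE hu hu0 hE hS hmax
      hφ hφ0 hφE
    rw [setIntegral_eq_integral_of_forall_compl_eq_zero (fun x hx => by simp [hφ0 x hx])]
    have h1 : ∀ x, |c * u x| ^ (p - 2) * (c * u x) * φ x =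
        S⁻¹ * c * (|u x| ^ (p - 2) * u x * φ x) := fun x => by
      rw [abs_mul, Real.mul_rpow (abs_nonneg _) (abs_nonneg _), hcp]
      ring
    have h2 : ∀ q : EuclideanSpace ℝ (Fin N) × EuclideanSpace ℝ (Fin N),
        (c * u q.1 - c * u q.2) * (φ q.1 - φ q.2) * K (q.1 - q.2) =
        c * ((u q.1 - u q.2) * (φ q.1 - φ q.2) * K (q.1 - q.2)) := fun q => by ring
    simp only [h1, h2, integral_const_mul]
    rw [← hL, ← hSdef]
    field_simp
end
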